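/- arXiv:1203.4833 — 9 statements merged into one kernel-verified Lean document; each statement's English description precedes it below -/
import Mathlib

section
/- Let (Ω, Σ, μ) be a measure space with 1 < μ(Ω) < ∞ and let f : Ω → [0,∞] be measurable. Then sup { ∫_Ω f·g dμ : g : Ω → [0,∞) measurable with ∫_Ω (e^g − 1 − g) dμ ≤ μ(Ω) } ≤ sup { ∫_Ω f·g dμ : g : Ω → [0,∞) measurable with ∫_Ω (e^g − 1 − g) dμ ≤ 1 } + log((7/2)·μ(Ω)) · ∫_Ω f dμ, all quantities interpreted in [0,∞]. -/
open MeasureTheory ENNReal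

lemma key_aux (M t : ℝ) (hM : 1 < M) (ht : 0 ≤ t) :
    M * (Real.exp t - 1 - t) ≤
      Real.exp (t + Real.log (7 / 2 * M)) - 1 - (t + Real.log (7 / 2 * M)) := by
  have hM0 : 0 < M := by linarith
  have h1 : Real.log (7 / 2 * M) ≤ 5 / 2 * M := by
    rw [Real.log_mul (by norm_num) hM0.ne']
    have a := Real.log_le_sub_one_of_pos hM0
    have b := Real.log_le_sub_one_of_pos (show (0 : ℝ) < 7 / 2 by norm_num)
    linarith
  rw [Real.exp_add, Real.exp_log (by positivity)]
  have h2 : 1 ≤ Real.exp t := Real.one_le_exp ht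
  nlinarith [mul_nonneg hM0.le (sub_nonneg.2 h2), mul_nonneg (sub_nonneg.2 hM.le) ht]

/-- Lemma `avequivB`: if `1 < μ(Ω) < ∞`, then
`‖f‖^av_{B,Ω} ≤ ‖f‖_{B,Ω} + log((7/2)·μ(Ω)) · ‖f‖_{L¹(Ω,μ)}`,
where both norms are given by duality against nonnegative measurable `g` with
`∫ (e^g − 1 − g) dμ ≤ μ(Ω)` (resp. `≤ 1`). -/
theorem avNormB_le {Ω : Type*} [MeasurableSpace Ω] (μ : Measure Ω)
    (hμ1 : 1 < μ Set.univ) (hμtop : μ Set.univ < ⊤)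
    (f : Ω → ℝ≥0∞) (hf : Measurable f) :
    sSup {r : ℝ≥0∞ | ∃ g : Ω → NNReal, Measurable g ∧
        (∫⁻ x, ENNReal.ofReal (Real.exp (g x) - 1 - (g x : ℝ)) ∂μ) ≤ μ Set.univ ∧
        r = ∫⁻ x, f x * (g x : ℝ≥0∞) ∂μ} ≤
      sSup {r : ℝ≥0∞ | ∃ g : Ω → NNReal, Measurable g ∧
        (∫⁻ x, ENNReal.ofReal (Real.exp (g x) - 1 - (g x : ℝ)) ∂μ) ≤ 1 ∧
        r = ∫⁻ x, f x * (g x : ℝ≥0∞) ∂μ} +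
      ENNReal.ofReal (Real.log ((7 / 2) * (μ Set.univ).toReal)) * ∫⁻ x, f x ∂μ := by
  apply sSup_le
  rintro r ⟨g, hg, hgi, rfl⟩
  set M : ℝ := (μ Set.univ).toReal with hMdef
  have hMe : ENNReal.ofReal M = μ Set.univ := ENNReal.ofReal_toReal hμtop.ne
  have hM : 1 < M := by
    rw [hMdef, ← ENNReal.toReal_one]
    exact (ENNReal.toReal_lt_toReal (by simp) hμtop.ne).2 hμ1
  have hL : 0 ≤ Real.log (7 / 2 * M) := Real.log_nonneg (by linarith)
  set L : NNReal := (Real.log (7 / 2 * M)).toNNReal with hLdef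
  have hLc : (L : ℝ) = Real.log (7 / 2 * M) := Real.coe_toNNReal _ hL
  have hLe : ENNReal.ofReal (Real.log (7 / 2 * M)) = (L : ℝ≥0∞) := rfl
  have hh : Measurable (fun x => g x - L) := hg.sub_const L
  have hint : (∫⁻ x, ENNReal.ofReal
      (Real.exp ((g x - L : NNReal) : ℝ) - 1 - ((g x - L : NNReal) : ℝ)) ∂μ) ≤ 1 := by
    have hle : μ Set.univ * (∫⁻ x, ENNReal.ofReal
      (Real.exp ((g x - L : NNReal) : ℝ) - 1 - ((g x - L : NNReal) : ℝ)) ∂μ)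
        ≤ μ Set.univ * 1 := by
      rw [mul_one, ← lintegral_const_mul' _ _ hμtop.ne]
      refine le_trans (lintegral_mono fun x => ?_) hgi
      dsimp only
      rw [← hMe, ← ENNReal.ofReal_mul (by linarith)]
      rcases le_total (g x) L with h | h
      · rw [tsub_eq_zero_of_le h]; simp
      · apply ENNReal.ofReal_le_ofReal
        have := key_aux M ((g x - L : NNReal) : ℝ) hM (NNReal.coe_nonneg _)
        rw [← hLc, ← NNReal.coe_add, tsub_add_cancel_of_le h] at this
        exact this
    exact (ENNReal.mul_le_mul_iff_right (by positivity) hμtop.ne).1 hle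
  rw [hLe, ← lintegral_const_mul' _ _ (by simp)]
  refine le_trans (b := (∫⁻ x, f x * ((g x - L : NNReal) : ℝ≥0∞) ∂μ) + ∫⁻ x, (L : ℝ≥0∞) * f x ∂μ)
    ?_ (add_le_add (le_sSup ?_) le_rfl)
  swap
  · exact ⟨fun x => g x - L, hh, hint, rfl⟩
  have hm : Measurable (fun x => f x * ((g x - L : NNReal) : ℝ≥0∞)) :=
    hf.mul hh.coe_nnreal_ennreal
  rw [← lintegral_add_left hm]
  refine lintegral_mono fun x => ?_
  dsimp only
  rw [mul_comm (L : ℝ≥0∞), ← mul_add, ← ENNReal.coe_add]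
  gcongr
  exact le_tsub_add
end

section
/- Let V : ℝ² → [0,∞) be Lebesgue integrable and let W : (0,∞) → [0,∞) be nonincreasing and equimeasurable with V, i.e. for every s > 0 the Lebesgue measure of {x ∈ ℝ² : W(|x|) > s} equals the Lebesgue measure of {x ∈ ℝ² : V(x) > s}. Then the Luxemburg norm ‖V‖_(B,ℝ²) := inf { κ > 0 : ∫_{ℝ²} B(V(x)/κ) dx ≤ 1 } satisfies ‖V‖_(B,ℝ²) ≤ (π + 4) · max { (1/π)·∫_{ℝ²} V(x) dx , ∫_{ℝ²} W(|x|)·log₊(1/|x|) dx }. -/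
open MeasureTheory ENNReal


lemma aux_B_integral (s : ℝ) (hs : 0 ≤ s) :
    ∫ t in (0:ℝ)..s, Real.log (1 + t) = (1 + s) * Real.log (1 + s) - s := by
  have h : ∀ x ∈ Set.uIcc 0 s, HasDerivAt (fun t : ℝ => (1 + t) * Real.log (1 + t) - t)
      (Real.log (1 + x)) x := by
    intro x hx
    rw [Set.uIcc_of_le hs] at hx
    have hx1 : (1 + x) ≠ 0 := by linarith [hx.1]
    have h1 : HasDerivAt (fun t : ℝ => 1 + t) 1 x := (hasDerivAt_id x).const_add 1
    have h2 := (h1.mul (h1.log hx1)).sub (hasDerivAt_id x)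
    have h3 : 1 * Real.log (1 + x) + (1 + x) * (1 / (1 + x)) - 1 = Real.log (1 + x) := by
      rw [mul_one_div_cancel hx1]
      ring
    rw [h3] at h2
    exact h2
  rw [intervalIntegral.integral_eq_sub_of_hasDerivAt h]
  · simp
  · apply ContinuousOn.intervalIntegrable
    intro x hx
    rw [Set.uIcc_of_le hs] at hx
    have hx1 : (1 + x) ≠ 0 := by linarith [hx.1]
    exact ((continuousAt_const.add continuousAt_id).log hx1).continuousWithinAt

lemma aux_layer {α : Type*} [MeasurableSpace α] (μ : Measure α) (f : α → ℝ)
    (hf : 0 ≤ᵐ[μ] f) (hm : AEMeasurable f μ) :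
    ∫⁻ x, ENNReal.ofReal ((1 + f x) * Real.log (1 + f x) - f x) ∂μ =
      ∫⁻ t in Set.Ioi (0:ℝ), μ {a | t < f a} * ENNReal.ofReal (Real.log (1 + t)) := by
  rw [← lintegral_comp_eq_lintegral_meas_lt_mul μ hf hm]
  · apply lintegral_congr_ae
    filter_upwards [hf] with x hx
    rw [aux_B_integral _ hx]
  · intro t ht
    apply ContinuousOn.intervalIntegrable
    intro x hx
    rw [Set.uIcc_of_le ht.le] at hx
    have hx1 : (1 + x) ≠ 0 := by linarith [hx.1]
    exact ((continuousAt_const.add continuousAt_id).log hx1).continuousWithinAt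
  · filter_upwards [ae_restrict_mem measurableSet_Ioi] with t ht
    exact Real.log_nonneg (by linarith [Set.mem_Ioi.1 ht])

lemma aux_ptwise (w r : ℝ) (hw : 0 ≤ w) (hr : 0 < r) (h : w * r ^ 2 ≤ 1) :
    (1 + w) * Real.log (1 + w) - w ≤ w * (2 * max (Real.log (1 / r)) 0 + 1) := by
  have h1 : Real.log (1 + w) ≤ w := by
    have := Real.log_le_sub_one_of_pos (show 0 < 1 + w by linarith)
    linarith
  have h2 : Real.log (1 + w) ≤ 2 * max (Real.log (1 / r)) 0 + 1 := by
    have l2 : Real.log 2 ≤ 1 := by linarith [Real.log_two_lt_d9]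
    rcases le_or_gt 1 r with hr1 | hr1
    · have : w ≤ 1 := (le_mul_of_one_le_right hw (one_le_pow₀ hr1)).trans h
      have := le_max_right (Real.log (1 / r)) 0
      linarith
    · have : 1 + w ≤ 2 * (1 / r) ^ 2 := by
        rw [one_div, inv_pow, ← div_eq_mul_inv, le_div_iff₀ (by positivity)]
        nlinarith
      have h3 := Real.log_le_log (by linarith) this
      rw [Real.log_mul (by norm_num) (by positivity), Real.log_pow] at h3
      have := le_max_left (Real.log (1 / r)) 0
      push_cast at h3
      linarith
  nlinarith [mul_le_mul_of_nonneg_left h2 hw]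

/-- Lemma `Orliczlem` (in Luxemburg-norm form): if `V ≥ 0` is integrable on `ℝ²` and
`W` is a nonincreasing function on `(0,∞)` equimeasurable with `V` (the spherical
rearrangement), then the Luxemburg norm `‖V‖_(B,ℝ²)` of `V` for
`B(s) = (1+s)·log(1+s) − s` satisfies
`‖V‖_(B,ℝ²) ≤ (π+4) · max{(1/π)·∫ V, ∫ W(|x|)·log₊(1/|x|) dx}`. -/
theorem luxemburgB_le_rearrangement
    (V : EuclideanSpace ℝ (Fin 2) → ℝ) (hV0 : ∀ x, 0 ≤ V x)
    (hVint : Integrable V)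
    (W : ℝ → ℝ) (hW0 : ∀ r, 0 < r → 0 ≤ W r)
    (hWmono : AntitoneOn W (Set.Ioi 0))
    (hequi : ∀ s : ℝ, 0 < s →
      volume {x : EuclideanSpace ℝ (Fin 2) | s < W ‖x‖} =
      volume {x : EuclideanSpace ℝ (Fin 2) | s < V x}) :
    sInf {κ : ℝ≥0∞ | 0 < κ ∧ κ < ⊤ ∧
        (∫⁻ x, ENNReal.ofReal
          ((1 + V x / κ.toReal) * Real.log (1 + V x / κ.toReal) - V x / κ.toReal)) ≤ 1} ≤
      ENNReal.ofReal (Real.pi + 4) *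
        max ((∫⁻ x, ENNReal.ofReal (V x)) / ENNReal.ofReal Real.pi)
          (∫⁻ x : EuclideanSpace ℝ (Fin 2),
            ENNReal.ofReal (W ‖x‖ * max (Real.log (1 / ‖x‖)) 0)) := by
  set N : ℝ≥0∞ := ∫⁻ x, ENNReal.ofReal (V x) with hN
  set L : ℝ≥0∞ := ∫⁻ x : EuclideanSpace ℝ (Fin 2),
            ENNReal.ofReal (W ‖x‖ * max (Real.log (1 / ‖x‖)) 0) with hL
  have hVm : AEMeasurable V := hVint.1.aemeasurable
  have hpos : ∀ᵐ x : EuclideanSpace ℝ (Fin 2), 0 < ‖x‖ := by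
    have : ∀ᵐ x : EuclideanSpace ℝ (Fin 2), x ≠ 0 := by
      simp [ae_iff]
    filter_upwards [this] with x hx using norm_pos_iff.2 hx
  have hWm : AEMeasurable (fun x : EuclideanSpace ℝ (Fin 2) => W ‖x‖) := by
    have h1 : Measurable (fun t : ℝ => W (Real.exp t)) := by
      apply Antitone.measurable
      intro a b hab
      exact hWmono (Real.exp_pos _) (Real.exp_pos _) (Real.exp_le_exp.2 hab)
    have h2 : Measurable (fun x : EuclideanSpace ℝ (Fin 2) => W (Real.exp (Real.log ‖x‖))) :=
      h1.comp (Real.measurable_log.comp measurable_norm)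
    refine h2.aemeasurable.congr ?_
    filter_upwards [hpos] with x hx
    rw [Real.exp_log hx]
  have hWn : ∀ᵐ x : EuclideanSpace ℝ (Fin 2), 0 ≤ W ‖x‖ := by
    filter_upwards [hpos] with x hx using hW0 _ hx
  have hNW : ∫⁻ x : EuclideanSpace ℝ (Fin 2), ENNReal.ofReal (W ‖x‖) = N := by
    rw [hN, lintegral_eq_lintegral_meas_lt _ hWn hWm,
      lintegral_eq_lintegral_meas_lt _ (Filter.Eventually.of_forall hV0) hVm]
    exact setLIntegral_congr_fun measurableSet_Ioi (fun t ht => hequi t ht)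
  have hNtop : N ≠ ⊤ := by
    rw [hN, ← ofReal_integral_eq_lintegral_ofReal hVint (Filter.Eventually.of_forall hV0)]
    exact ENNReal.ofReal_ne_top
  have hpi := Real.pi_pos
  set M : ℝ≥0∞ := max (N / ENNReal.ofReal Real.pi) L with hM
  rcases eq_or_ne M ⊤ with hMt | hMt
  · rw [hMt, ENNReal.mul_top (by simp; linarith)]
    exact le_top
  rcases eq_or_ne M 0 with hM0 | hM0
  · have hN0 : N = 0 := by
      have h1 : N / ENNReal.ofReal Real.pi = 0 :=
        le_antisymm (hM0 ▸ le_max_left _ _) zero_le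
      simpa using h1
    have hV : ∀ᵐ x, V x = 0 := by
      have := (lintegral_eq_zero_iff' hVm.ennreal_ofReal).1 hN0
      filter_upwards [this] with x hx
      exact le_antisymm (ENNReal.ofReal_eq_zero.1 hx) (hV0 x)
    rw [hM0, mul_zero]
    refine le_of_forall_gt_imp_ge_of_dense ?_
    intro a ha
    obtain ⟨b, hb0, hba⟩ := exists_between ha
    refine le_trans (sInf_le (a := b) ?_) hba.le
    refine ⟨hb0, hba.trans_le le_top, ?_⟩
    have : (∫⁻ x, ENNReal.ofReal
          ((1 + V x / b.toReal) * Real.log (1 + V x / b.toReal) - V x / b.toReal)) =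
          ∫⁻ x : EuclideanSpace ℝ (Fin 2), 0 := by
      apply lintegral_congr_ae
      filter_upwards [hV] with x hx
      simp [hx]
    rw [this]
    simp
  -- main case
  obtain ⟨m, hm⟩ : ∃ m, m = M.toReal := ⟨_, rfl⟩
  have hm0 : 0 < m := hm ▸ ENNReal.toReal_pos hM0 hMt
  have hMm : M = ENNReal.ofReal m := by rw [hm, ENNReal.ofReal_toReal hMt]
  have hLm : L ≤ ENNReal.ofReal m := hMm ▸ le_max_right _ _
  have hNm : N ≤ ENNReal.ofReal (Real.pi * m) := by
    have h1 : N / ENNReal.ofReal Real.pi ≤ ENNReal.ofReal m := hMm ▸ le_max_left _ _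
    rw [ENNReal.div_le_iff (by simpa using hpi) ENNReal.ofReal_ne_top,
      ← ENNReal.ofReal_mul hm0.le] at h1
    rwa [mul_comm]
  have hWr : ∀ r, 0 < r → W r * r ^ 2 ≤ m := by
    intro r hr
    have h1 : ENNReal.ofReal (W r) * volume (Metric.ball (0 : EuclideanSpace ℝ (Fin 2)) r) ≤ N := by
      rw [← hNW, ← setLIntegral_const]
      refine le_trans ?_ (setLIntegral_le_lintegral (Metric.ball 0 r) _)
      apply lintegral_mono_ae
      filter_upwards [ae_restrict_mem Metric.isOpen_ball.measurableSet, ae_restrict_of_ae hpos]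
        with x hx hx0
      apply ENNReal.ofReal_le_ofReal
      exact hWmono hx0 hr (by simpa using (mem_ball_zero_iff.1 hx).le)
    rw [EuclideanSpace.volume_ball_fin_two] at h1
    have h2 := h1.trans hNm
    rw [show ENNReal.ofReal r ^ 2 * ENNReal.ofReal Real.pi = ENNReal.ofReal (r ^ 2 * Real.pi) by
      rw [ENNReal.ofReal_mul (by positivity), ENNReal.ofReal_pow hr.le],
      ← ENNReal.ofReal_mul (hW0 r hr), ENNReal.ofReal_le_ofReal_iff (by positivity)] at h2
    have h3 : Real.pi * (W r * r ^ 2) ≤ Real.pi * m := by linarith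
    exact le_of_mul_le_mul_left h3 hpi
  set k : ℝ := (Real.pi + 4) * m with hk
  have hk0 : 0 < k := by positivity
  have hkM : ENNReal.ofReal (Real.pi + 4) * M = ENNReal.ofReal k := by
    rw [hMm, hk, ENNReal.ofReal_mul (by positivity)]
  rw [hkM]
  apply sInf_le
  refine ⟨by simpa using hk0, ENNReal.ofReal_lt_top, ?_⟩
  rw [ENNReal.toReal_ofReal hk0.le]
  have hswap : ∫⁻ x, ENNReal.ofReal ((1 + V x / k) * Real.log (1 + V x / k) - V x / k) =
      ∫⁻ x : EuclideanSpace ℝ (Fin 2),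
        ENNReal.ofReal ((1 + W ‖x‖ / k) * Real.log (1 + W ‖x‖ / k) - W ‖x‖ / k) := by
    rw [aux_layer volume (fun x => V x / k)
        (Filter.Eventually.of_forall fun x => div_nonneg (hV0 x) hk0.le) (hVm.div_const k),
      aux_layer volume (fun x : EuclideanSpace ℝ (Fin 2) => W ‖x‖ / k)
        (by filter_upwards [hWn] with x hx using div_nonneg hx hk0.le) (hWm.div_const k)]
    refine setLIntegral_congr_fun measurableSet_Ioi (fun t ht => ?_)
    have := hequi (t * k) (mul_pos ht hk0)
    simp only [lt_div_iff₀ hk0]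
    rw [this]
  rw [hswap]
  have hbd : ∫⁻ x : EuclideanSpace ℝ (Fin 2),
        ENNReal.ofReal ((1 + W ‖x‖ / k) * Real.log (1 + W ‖x‖ / k) - W ‖x‖ / k) ≤
      ∫⁻ x : EuclideanSpace ℝ (Fin 2),
        (ENNReal.ofReal (2 / k) * ENNReal.ofReal (W ‖x‖ * max (Real.log (1 / ‖x‖)) 0)
          + ENNReal.ofReal (1 / k) * ENNReal.ofReal (W ‖x‖)) := by
    apply lintegral_mono_ae
    filter_upwards [hpos] with x hx
    have hw := hW0 _ hx
    have hl := le_max_right (Real.log (1 / ‖x‖)) 0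
    rw [← ENNReal.ofReal_mul (by positivity), ← ENNReal.ofReal_mul (by positivity),
      ← ENNReal.ofReal_add (by positivity) (by positivity)]
    apply ENNReal.ofReal_le_ofReal
    refine (aux_ptwise (W ‖x‖ / k) ‖x‖ (by positivity) hx ?_).trans (le_of_eq (by ring))
    rw [div_mul_eq_mul_div, div_le_one hk0]
    have := hWr _ hx
    nlinarith
  refine hbd.trans ?_
  rw [lintegral_add_right' _ (hWm.ennreal_ofReal.const_mul _),
    lintegral_const_mul' _ _ ENNReal.ofReal_ne_top,
    lintegral_const_mul' _ _ ENNReal.ofReal_ne_top, hNW, ← hL]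
  calc _ ≤ ENNReal.ofReal (2 / k) * ENNReal.ofReal m
        + ENNReal.ofReal (1 / k) * ENNReal.ofReal (Real.pi * m) := by gcongr
    _ = ENNReal.ofReal (2 / k * m + 1 / k * (Real.pi * m)) := by
        rw [← ENNReal.ofReal_mul (by positivity), ← ENNReal.ofReal_mul (by positivity),
          ← ENNReal.ofReal_add (by positivity) (by positivity)]
    _ ≤ 1 := by
        rw [ENNReal.ofReal_le_one]
        have : 2 / k * m + 1 / k * (Real.pi * m) = ((2 + Real.pi) * m) / k := by ring
        rw [this, div_le_one hk0, hk]
        nlinarith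
end

section
/- Let V : ℝ² → [0,∞) be measurable and let W : (0,∞) → [0,∞) be nonincreasing and equimeasurable with V, i.e. for every s > 0 the Lebesgue measure of {x ∈ ℝ² : W(|x|) > s} equals the Lebesgue measure of {x ∈ ℝ² : V(x) > s}. Then ∫_{ℝ²} W(|x|)·log₊(1/|x|) dx ≤ 4π · ‖V‖_{B,ℝ²}, where ‖V‖_{B,ℝ²} := sup { ∫_{ℝ²} V·g dx : g : ℝ² → [0,∞) measurable with ∫_{ℝ²} (e^{g} − 1 − g) dx ≤ 1 }, all quantities interpreted in [0,∞]. -/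
open MeasureTheory ENNReal

lemma aux_young (u G : ℝ) (hu : 0 ≤ u) :
    u * G ≤ ((1 + u) * Real.log (1 + u) - u) + (Real.exp G - 1 - G) := by
  have hy : 0 < 1 + u := by linarith
  have h1 := Real.add_one_le_exp (G - Real.log (1 + u))
  rw [Real.exp_sub, Real.exp_log hy, le_div_iff₀ hy] at h1
  nlinarith

lemma aux_A_nonneg (t : ℝ) : 0 ≤ Real.exp t - 1 - t := by
  linarith [Real.add_one_le_exp t]

lemma aux_B_nonneg (u : ℝ) (hu : 0 ≤ u) : 0 ≤ (1 + u) * Real.log (1 + u) - u := by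
  have := aux_young u 0 hu
  simpa using this

lemma aux_A_div (t c : ℝ) (hc : 1 ≤ c) :
    Real.exp (t / c) - 1 - t / c ≤ (Real.exp t - 1 - t) / c := by
  have h0 : 0 < c := by linarith
  have h := convexOn_exp.2 (Set.mem_univ t) (Set.mem_univ (0:ℝ))
    (show (0:ℝ) ≤ 1 / c by positivity)
    (show (0:ℝ) ≤ 1 - 1 / c by rw [sub_nonneg, div_le_one h0]; exact hc) (by ring)
  simp only [smul_eq_mul, Real.exp_zero, mul_zero, add_zero, mul_one] at h
  have e : 1 / c * t = t / c := by ring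
  rw [e] at h
  have : (Real.exp t - 1 - t) / c = 1 / c * Real.exp t - 1 / c - t / c := by ring
  linarith

lemma aux_B_int (u : ℝ) (hu : 0 ≤ u) :
    ∫ t in (0:ℝ)..u, Real.log (1 + t) = (1 + u) * Real.log (1 + u) - u := by
  have h := intervalIntegral.integral_comp_add_left (fun x => Real.log x) (a := 0) (b := u) (1:ℝ)
  rw [h, integral_log]
  simp
  ring

lemma aux_log_ii (u : ℝ) (hu : 0 < u) :
    IntervalIntegrable (fun t => Real.log (1 + t)) volume 0 u := by
  apply ContinuousOn.intervalIntegrable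
  apply ContinuousOn.log (by fun_prop)
  intro x hx
  rw [Set.uIcc_of_le hu.le] at hx
  linarith [hx.1]

lemma aux_disc :
    (∫⁻ x : EuclideanSpace ℝ (Fin 2),
      ENNReal.ofReal (Real.exp (max (Real.log (1 / ‖x‖)) 0) - 1 - max (Real.log (1 / ‖x‖)) 0))
      ≤ ENNReal.ofReal (2 * Real.pi) := by
  set f : ℝ → ℝ := (Set.Iio 1).indicator (fun r => r⁻¹) with hf
  have hfe : ∀ y ∈ Set.Ioi (0:ℝ), y ^ (Module.finrank ℝ (EuclideanSpace ℝ (Fin 2)) - 1) • f y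
      = (Set.Ioo (0:ℝ) 1).indicator (fun _ => (1:ℝ)) y := by
    intro y hy
    have hy' : (0:ℝ) < y := hy
    by_cases h1 : y < 1 <;> simp [hf, Set.indicator, h1, hy', hy'.ne']
  have hint : Integrable (fun x : EuclideanSpace ℝ (Fin 2) => f ‖x‖) volume := by
    rw [integrable_fun_norm_addHaar, integrableOn_congr_fun hfe measurableSet_Ioi]
    apply Integrable.integrableOn
    rw [integrable_indicator_iff measurableSet_Ioo]
    simp
  have hval : ∫ x : EuclideanSpace ℝ (Fin 2), f ‖x‖ = 2 * Real.pi := by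
    rw [integral_fun_norm_addHaar, setIntegral_congr_fun measurableSet_Ioi hfe,
      setIntegral_indicator measurableSet_Ioo]
    have : Set.Ioi (0:ℝ) ∩ Set.Ioo 0 1 = Set.Ioo 0 1 := by
      ext x; simp
    rw [this]
    simp [Measure.real, EuclideanSpace.volume_ball, Real.pi_pos.le, Real.sq_sqrt, one_add_one_eq_two, Real.Gamma_two]
  have hf0 : ∀ x : EuclideanSpace ℝ (Fin 2), 0 ≤ f ‖x‖ := by
    intro x
    by_cases h : ‖x‖ < 1 <;> simp [hf, Set.indicator, h]
  rw [← hval, ofReal_integral_eq_lintegral_ofReal hint (Filter.Eventually.of_forall hf0)]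
  apply lintegral_mono_ae
  have h0 : ∀ᵐ x : EuclideanSpace ℝ (Fin 2), x ≠ 0 := by
    simp [ae_iff]
  filter_upwards [h0] with x hx
  apply ENNReal.ofReal_le_ofReal
  have hx' : 0 < ‖x‖ := norm_pos_iff.2 hx
  by_cases h : ‖x‖ < 1
  · have hl : 0 ≤ Real.log (1 / ‖x‖) := Real.log_nonneg (by rw [le_div_iff₀ hx']; linarith)
    rw [max_eq_left hl, Real.exp_log (by positivity)]
    simp only [hf, Set.indicator, Set.mem_Iio, h, if_true]
    rw [one_div] at *
    linarith
  · have hl : Real.log (1 / ‖x‖) ≤ 0 := Real.log_nonpos (by positivity)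
      (by rw [div_le_one hx']; linarith)
    rw [max_eq_right hl]
    simpa using hf0 x

/-- Luxemburg bound for a truncated function. -/
lemma aux_trunc (V U : EuclideanSpace ℝ (Fin 2) → ℝ) (hU0 : ∀ x, 0 ≤ U x)
    (hUV : ∀ x, U x ≤ V x)
    (hUm : Measurable U) (l : ℝ) (hl : 0 < l)
    (hfin : (∫⁻ x, ENNReal.ofReal (U x / l)) < ∞)
    (hN : ∀ g : EuclideanSpace ℝ (Fin 2) → NNReal, Measurable g →
          (∫⁻ x, ENNReal.ofReal (Real.exp (g x) - 1 - (g x : ℝ))) ≤ 1 →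
          ∫⁻ x, ENNReal.ofReal (V x) * (g x : ℝ≥0∞) ≤ ENNReal.ofReal l) :
    (∫⁻ x, ENNReal.ofReal ((1 + U x / l) * Real.log (1 + U x / l) - U x / l)) ≤ 1 := by
  have hu0 : ∀ x, 0 ≤ U x / l := fun x => div_nonneg (hU0 x) hl.le
  have hlog0 : ∀ x, 0 ≤ Real.log (1 + U x / l) := fun x => Real.log_nonneg (by linarith [hu0 x])
  have hA : ∀ x, Real.exp (Real.log (1 + U x / l)) - 1 - Real.log (1 + U x / l)
      = U x / l - Real.log (1 + U x / l) := by
    intro x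
    rw [Real.exp_log (by linarith [hu0 x])]; ring
  set a : ℝ≥0∞ := ∫⁻ x, ENNReal.ofReal
    (Real.exp (Real.log (1 + U x / l)) - 1 - Real.log (1 + U x / l)) with ha
  have hafin : a < ∞ := by
    refine lt_of_le_of_lt (lintegral_mono fun x => ENNReal.ofReal_le_ofReal ?_) hfin
    rw [hA]; linarith [hlog0 x]
  set c : ℝ := max a.toReal 1 with hc
  have hc1 : 1 ≤ c := le_max_right _ _
  have hc0 : 0 < c := by linarith
  have hcE : ENNReal.ofReal c = max a 1 := by
    rw [hc, ENNReal.ofReal_max, ENNReal.ofReal_toReal hafin.ne, ENNReal.ofReal_one]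
  have hgm : Measurable (fun x => Real.toNNReal (Real.log (1 + U x / l) / c)) := by fun_prop
  have key := hN _ hgm (by
    calc _ ≤ ∫⁻ x, ENNReal.ofReal
            (Real.exp (Real.log (1 + U x / l)) - 1 - Real.log (1 + U x / l))
              * ENNReal.ofReal c⁻¹ := by
          apply lintegral_mono
          intro x
          simp only
          rw [Real.coe_toNNReal _ (div_nonneg (hlog0 x) hc0.le),
            ← ENNReal.ofReal_mul (aux_A_nonneg _), ← div_eq_mul_inv]
          exact ENNReal.ofReal_le_ofReal (aux_A_div _ _ hc1)
      _ = a * ENNReal.ofReal c⁻¹ := by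
          rw [lintegral_mul_const _ (by fun_prop)]
      _ ≤ ENNReal.ofReal c * ENNReal.ofReal c⁻¹ := by
          gcongr; rw [hcE]; exact le_max_left _ _
      _ = 1 := by
          rw [← ENNReal.ofReal_mul hc0.le, mul_inv_cancel₀ hc0.ne', ENNReal.ofReal_one])
  have key2 : a + (∫⁻ x, ENNReal.ofReal ((1 + U x / l) * Real.log (1 + U x / l) - U x / l))
      ≤ max a 1 := by
    rw [ha, ← lintegral_add_left (by fun_prop), ← ha]
    calc _ ≤ ∫⁻ x, ENNReal.ofReal (V x) *
            (Real.toNNReal (Real.log (1 + U x / l) / c) : ℝ≥0∞) * ENNReal.ofReal (c / l) := by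
          apply lintegral_mono
          intro x
          simp only
          rw [← ENNReal.ofReal_add (aux_A_nonneg _) (aux_B_nonneg _ (hu0 x)),
            ← ENNReal.ofReal.eq_1, mul_assoc,
            ← ENNReal.ofReal_mul (div_nonneg (hlog0 x) hc0.le),
            ← ENNReal.ofReal_mul ((hU0 x).trans (hUV x))]
          apply ENNReal.ofReal_le_ofReal
          rw [hA]
          have e1 : Real.log (1 + U x / l) / c * (c / l) = Real.log (1 + U x / l) / l := by
            field_simp
          rw [e1]
          have e2 : U x * (Real.log (1 + U x / l) / l) ≤ V x * (Real.log (1 + U x / l) / l) :=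
            mul_le_mul_of_nonneg_right (hUV x) (div_nonneg (hlog0 x) hl.le)
          have e3 : U x * (Real.log (1 + U x / l) / l) = U x / l * Real.log (1 + U x / l) := by
            ring
          linarith
      _ = (∫⁻ x, ENNReal.ofReal (V x) *
            (Real.toNNReal (Real.log (1 + U x / l) / c) : ℝ≥0∞)) * ENNReal.ofReal (c / l) := by
          rw [lintegral_mul_const' _ _ ENNReal.ofReal_ne_top]
      _ ≤ ENNReal.ofReal l * ENNReal.ofReal (c / l) := by gcongr
      _ = max a 1 := by
          rw [← ENNReal.ofReal_mul hl.le, ← hcE]; congr 1; field_simp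
  rcases le_total a 1 with h | h
  · rw [max_eq_right h] at key2
    exact le_add_self.trans key2
  · rw [max_eq_left h] at key2
    exact (ENNReal.add_le_add_iff_left hafin.ne).1 (key2.trans le_self_add)

lemma aux_lux (V : EuclideanSpace ℝ (Fin 2) → ℝ) (hV0 : ∀ x, 0 ≤ V x)
    (hVm : Measurable V) (l : ℝ) (hl : 0 < l)
    (hN : ∀ g : EuclideanSpace ℝ (Fin 2) → NNReal, Measurable g →
          (∫⁻ x, ENNReal.ofReal (Real.exp (g x) - 1 - (g x : ℝ))) ≤ 1 →
          ∫⁻ x, ENNReal.ofReal (V x) * (g x : ℝ≥0∞) ≤ ENNReal.ofReal l) :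
    (∫⁻ x, ENNReal.ofReal ((1 + V x / l) * Real.log (1 + V x / l) - V x / l)) ≤ 1 := by
  set U : ℕ → EuclideanSpace ℝ (Fin 2) → ℝ := fun n =>
    (Metric.ball 0 (n:ℝ)).indicator (fun x => min (V x) n) with hU
  have hUm : ∀ n, Measurable (U n) := fun n =>
    (hVm.min measurable_const).indicator measurableSet_ball
  have hmin : ∀ n : ℕ, ∀ x, 0 ≤ min (V x) (n:ℝ) := fun n x => le_min (hV0 x) (Nat.cast_nonneg n)
  have hU0 : ∀ n x, 0 ≤ U n x := fun n x => Set.indicator_nonneg (fun y _ => hmin n y) x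
  have hUV : ∀ n x, U n x ≤ V x := fun n x =>
    Set.indicator_le' (fun y _ => min_le_left _ _) (fun y _ => hV0 y) x
  have hb : ∀ n, (∫⁻ x, ENNReal.ofReal
      ((1 + U n x / l) * Real.log (1 + U n x / l) - U n x / l)) ≤ 1 := by
    intro n
    refine aux_trunc V (U n) (hU0 n) (hUV n) (hUm n) l hl ?_ hN
    calc _ ≤ ∫⁻ x, (Metric.ball (0 : EuclideanSpace ℝ (Fin 2)) (n:ℝ)).indicator
            (fun _ => ENNReal.ofReal (n / l)) x := by
          apply lintegral_mono
          intro x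
          by_cases hx : x ∈ Metric.ball (0 : EuclideanSpace ℝ (Fin 2)) (n:ℝ)
          · simp only [hU, Set.indicator_of_mem hx]
            apply ENNReal.ofReal_le_ofReal
            gcongr
            exact min_le_right _ _
          · simp only [hU, Set.indicator_of_notMem hx]
            simp
      _ = ENNReal.ofReal (n / l) * volume (Metric.ball (0 : EuclideanSpace ℝ (Fin 2)) (n:ℝ)) :=
          lintegral_indicator_const measurableSet_ball _
      _ < ∞ := ENNReal.mul_lt_top ENNReal.ofReal_lt_top measure_ball_lt_top
  have hev : ∀ x, ∀ᶠ n in Filter.atTop, U n x = V x := by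
    intro x
    obtain ⟨m, hm⟩ := exists_nat_gt (max (V x) ‖x‖)
    filter_upwards [Filter.eventually_ge_atTop m] with n hn
    have hn' : (m:ℝ) ≤ n := by exact_mod_cast hn
    have h1 := (le_max_left (V x) ‖x‖)
    have h2 := (le_max_right (V x) ‖x‖)
    have hx : x ∈ Metric.ball (0 : EuclideanSpace ℝ (Fin 2)) (n:ℝ) := by
      simp; linarith
    simp only [hU, Set.indicator_of_mem hx]
    exact min_eq_left (by linarith)
  have hlim : ∀ x, ENNReal.ofReal ((1 + V x / l) * Real.log (1 + V x / l) - V x / l)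
      = Filter.liminf (fun n => ENNReal.ofReal
      ((1 + U n x / l) * Real.log (1 + U n x / l) - U n x / l)) Filter.atTop := by
    intro x
    symm
    apply Filter.Tendsto.liminf_eq
    apply tendsto_const_nhds.congr'
    filter_upwards [hev x] with n hn
    rw [hn]
  simp_rw [hlim]
  refine (lintegral_liminf_le fun n => ?_).trans ?_
  · have := hUm n
    fun_prop
  · exact (Filter.liminf_le_liminf (Filter.Eventually.of_forall hb)).trans (by simp)

lemma aux_equi (f h : EuclideanSpace ℝ (Fin 2) → ℝ) (hf0 : ∀ x, 0 ≤ f x)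
    (hf : Measurable f) (hh0 : ∀ x, 0 ≤ h x) (hh : Measurable h) (l : ℝ) (hl : 0 < l)
    (he : ∀ s : ℝ, 0 < s → volume {x | s < f x} = volume {x | s < h x}) :
    (∫⁻ x, ENNReal.ofReal ((1 + f x / l) * Real.log (1 + f x / l) - f x / l))
    = ∫⁻ x, ENNReal.ofReal ((1 + h x / l) * Real.log (1 + h x / l) - h x / l) := by
  have key : ∀ f : EuclideanSpace ℝ (Fin 2) → ℝ, (∀ x, 0 ≤ f x) → Measurable f →
      (∫⁻ x, ENNReal.ofReal ((1 + f x / l) * Real.log (1 + f x / l) - f x / l))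
      = ∫⁻ t in Set.Ioi 0, volume {x | t * l < f x} * ENNReal.ofReal (Real.log (1 + t)) := by
    intro f hf0 hf
    have h0 : ∀ x, 0 ≤ f x / l := fun x => div_nonneg (hf0 x) hl.le
    have := lintegral_comp_eq_lintegral_meas_lt_mul (f := fun x => f x / l)
      (g := fun t => Real.log (1 + t)) volume
      (Filter.Eventually.of_forall h0) (hf.div_const l).aemeasurable
      (fun t ht => aux_log_ii t ht) (by
        filter_upwards [ae_restrict_mem measurableSet_Ioi] with t ht
        exact Real.log_nonneg (by have : (0:ℝ) < t := ht
                                  linarith))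
    simp_rw [lt_div_iff₀ hl] at this
    rw [← this]
    apply lintegral_congr
    intro x
    rw [aux_B_int _ (h0 x)]
  rw [key f hf0 hf, key h hh0 hh]
  apply setLIntegral_congr_fun measurableSet_Ioi
  intro t ht
  have : (0:ℝ) < t := ht
  simp only
  rw [he _ (by positivity)]

/-- Lemma `Orliczlem2`: if `V ≥ 0` is measurable on `ℝ²` and `W` is nonincreasing on
`(0,∞)` and equimeasurable with `V` (the spherical rearrangement), then
`∫ W(|x|)·log₊(1/|x|) dx ≤ 4π · ‖V‖_{B,ℝ²}`, where `‖V‖_{B,ℝ²}` is the Orlicz norm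
given by duality against nonnegative measurable `g` with `∫ (e^g − 1 − g) dx ≤ 1`. -/
theorem rearrangement_log_le_orliczB
    (V : EuclideanSpace ℝ (Fin 2) → ℝ) (hV0 : ∀ x, 0 ≤ V x) (hVmeas : Measurable V)
    (W : ℝ → ℝ) (hW0 : ∀ r, 0 < r → 0 ≤ W r)
    (hWmono : AntitoneOn W (Set.Ioi 0))
    (hequi : ∀ s : ℝ, 0 < s →
      volume {x : EuclideanSpace ℝ (Fin 2) | s < W ‖x‖} =
      volume {x : EuclideanSpace ℝ (Fin 2) | s < V x}) :
    (∫⁻ x : EuclideanSpace ℝ (Fin 2),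
        ENNReal.ofReal (W ‖x‖ * max (Real.log (1 / ‖x‖)) 0)) ≤
      ENNReal.ofReal (4 * Real.pi) *
        sSup {r : ℝ≥0∞ | ∃ g : EuclideanSpace ℝ (Fin 2) → NNReal, Measurable g ∧
          (∫⁻ x, ENNReal.ofReal (Real.exp (g x) - 1 - (g x : ℝ))) ≤ 1 ∧
          r = ∫⁻ x, ENNReal.ofReal (V x) * (g x : ℝ≥0∞)} := by
  set W' : ℝ → ℝ := (Set.Ioi 0).indicator W with hW'
  have hW'0 : ∀ r, 0 ≤ W' r := fun r => Set.indicator_nonneg (fun y hy => hW0 y hy) r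
  have hW'm : Measurable W' := by
    apply measurable_of_Ioi
    intro s
    by_cases hs : s < 0
    · have : W' ⁻¹' Set.Ioi s = Set.univ := by
        ext r
        simp only [Set.mem_preimage, Set.mem_Ioi, Set.mem_univ, iff_true]
        exact hs.trans_le (hW'0 r)
      rw [this]; exact MeasurableSet.univ
    · have hmem : ∀ r, s < W' r ↔ 0 < r ∧ s < W r := by
        intro r
        by_cases hr : 0 < r
        · simp [hW', Set.indicator, hr]
        · simp [hW', Set.indicator, hr, not_lt.1 hs]
      apply Set.OrdConnected.measurableSet
      constructor
      intro x hx y hy z hz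
      have hx' := (hmem x).1 hx
      have hy' := (hmem y).1 hy
      have hz0 : 0 < z := hx'.1.trans_le hz.1
      exact (hmem z).2 ⟨hz0, hy'.2.trans_le (hWmono hz0 hy'.1 hz.2)⟩
  have h0 : ∀ᵐ x : EuclideanSpace ℝ (Fin 2), x ≠ 0 := by
    simp [ae_iff]
  have hWae : ∀ᵐ x : EuclideanSpace ℝ (Fin 2), W ‖x‖ = W' ‖x‖ := by
    filter_upwards [h0] with x hx
    have hx' : 0 < ‖x‖ := norm_pos_iff.2 hx
    simp [hW', Set.indicator, hx']
  set N := sSup {r : ℝ≥0∞ | ∃ g : EuclideanSpace ℝ (Fin 2) → NNReal, Measurable g ∧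
          (∫⁻ x, ENNReal.ofReal (Real.exp (g x) - 1 - (g x : ℝ))) ≤ 1 ∧
          r = ∫⁻ x, ENNReal.ofReal (V x) * (g x : ℝ≥0∞)} with hNdef
  have hpi := Real.pi_gt_three
  have main : ∀ l : ℝ, 0 < l → N ≤ ENNReal.ofReal l →
      (∫⁻ x : EuclideanSpace ℝ (Fin 2),
        ENNReal.ofReal (W ‖x‖ * max (Real.log (1 / ‖x‖)) 0)) ≤
      ENNReal.ofReal (4 * Real.pi) * ENNReal.ofReal l := by
    intro l hl hNl
    have hB := aux_lux V hV0 hVmeas l hl (fun g hg hg1 =>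
      (le_sSup (show _ ∈ {r : ℝ≥0∞ | ∃ g : EuclideanSpace ℝ (Fin 2) → NNReal, Measurable g ∧
          (∫⁻ x, ENNReal.ofReal (Real.exp (g x) - 1 - (g x : ℝ))) ≤ 1 ∧
          r = ∫⁻ x, ENNReal.ofReal (V x) * (g x : ℝ≥0∞)} from ⟨g, hg, hg1, rfl⟩)).trans hNl)
    have hBW := aux_equi (fun x => W' ‖x‖) V (fun x => hW'0 _) (hW'm.comp measurable_norm)
      hV0 hVmeas l hl (fun s hs => by
        rw [← hequi s hs]
        apply measure_congr
        filter_upwards [hWae] with x hx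
        have : (s < W' ‖x‖) = (s < W ‖x‖) := by rw [hx]
        exact this)
    calc _ ≤ ∫⁻ x : EuclideanSpace ℝ (Fin 2), ENNReal.ofReal l *
          (ENNReal.ofReal ((1 + W' ‖x‖ / l) * Real.log (1 + W' ‖x‖ / l) - W' ‖x‖ / l) +
           ENNReal.ofReal (Real.exp (max (Real.log (1 / ‖x‖)) 0) - 1
            - max (Real.log (1 / ‖x‖)) 0)) := by
          apply lintegral_mono_ae
          filter_upwards [hWae] with x hx
          have hq : 0 ≤ W' ‖x‖ / l := div_nonneg (hW'0 _) hl.le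
          rw [hx, ← ENNReal.ofReal_add (aux_B_nonneg _ hq) (aux_A_nonneg _),
            ← ENNReal.ofReal_mul hl.le]
          apply ENNReal.ofReal_le_ofReal
          have hy := mul_le_mul_of_nonneg_left
            (aux_young (W' ‖x‖ / l) (max (Real.log (1 / ‖x‖)) 0) hq) hl.le
          refine le_trans (le_of_eq ?_) hy
          field_simp
      _ = ENNReal.ofReal l * ((∫⁻ x : EuclideanSpace ℝ (Fin 2),
          ENNReal.ofReal ((1 + W' ‖x‖ / l) * Real.log (1 + W' ‖x‖ / l) - W' ‖x‖ / l)) +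
          ∫⁻ x : EuclideanSpace ℝ (Fin 2),
            ENNReal.ofReal (Real.exp (max (Real.log (1 / ‖x‖)) 0) - 1
            - max (Real.log (1 / ‖x‖)) 0)) := by
          rw [lintegral_const_mul' _ _ ENNReal.ofReal_ne_top, lintegral_add_left (by fun_prop)]
      _ ≤ ENNReal.ofReal l * (1 + ENNReal.ofReal (2 * Real.pi)) := by
          gcongr
          · exact hBW.le.trans hB
          · exact aux_disc
      _ ≤ ENNReal.ofReal l * ENNReal.ofReal (4 * Real.pi) := by
          gcongr
          rw [← ENNReal.ofReal_one, ← ENNReal.ofReal_add zero_le_one (by positivity)]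
          apply ENNReal.ofReal_le_ofReal
          linarith
      _ = _ := mul_comm _ _
  by_cases hNtop : N = ∞
  · rw [hNtop, ENNReal.mul_top (by simp [Real.pi_pos])]
    exact le_top
  · have hlim : Filter.Tendsto (fun e : ℝ => ENNReal.ofReal (4 * Real.pi) *
        ENNReal.ofReal (N.toReal + e)) (nhdsWithin 0 (Set.Ioi 0))
        (nhds (ENNReal.ofReal (4 * Real.pi) * N)) := by
      apply ENNReal.Tendsto.const_mul _ (Or.inr ENNReal.ofReal_ne_top)
      have : Filter.Tendsto (fun e : ℝ => ENNReal.ofReal (N.toReal + e)) (nhds 0)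
          (nhds (ENNReal.ofReal (N.toReal + 0))) :=
        ENNReal.tendsto_ofReal (tendsto_const_nhds.add Filter.tendsto_id)
      rw [add_zero, ENNReal.ofReal_toReal hNtop] at this
      exact this.mono_left nhdsWithin_le_nhds
    apply ge_of_tendsto hlim
    filter_upwards [self_mem_nhdsWithin] with e he
    have he' : (0:ℝ) < e := he
    refine main _ (by positivity) ?_
    rw [← ENNReal.ofReal_toReal hNtop]
    apply ENNReal.ofReal_le_ofReal
    rw [ENNReal.toReal_ofReal ENNReal.toReal_nonneg]
    linarith
end

section
/- Let q > σ > 0, c > 0, and let a : ℤ → ℝ be a sequence. Then the following are equivalent: (i) there exist C > 0 and α₀ ≥ 1 such that for all α ≥ α₀, ∑_{n : α·|a_n| > c} (α·|a_n|)^σ ≤ C·α^q (the sum over all n ∈ ℤ with α·|a_n| > c, interpreted in [0,∞]); (ii) there exist C' > 0 and s₀ > 0 such that for all 0 < s ≤ s₀, card{ n ∈ ℤ : |a_n| > s } ≤ C'·s^{−q}. -/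
open ENNReal

theorem card_le_global (q : ℝ) (hq : 0 < q) (a : ℤ → ℝ) (C' s₀ : ℝ) (hC : 0 < C') (hs₀ : 0 < s₀)
    (h : ∀ s : ℝ, 0 < s → s ≤ s₀ →
        ({n : ℤ | s < |a n|}.encard : ℝ≥0∞) ≤ ENNReal.ofReal (C' * s ^ (-q))) :
    ∃ K : ℝ, 0 < K ∧ ∀ s : ℝ, 0 < s →
        ({n : ℤ | s < |a n|}.encard : ℝ≥0∞) ≤ ENNReal.ofReal (K * s ^ (-q)) := by
  have hfin : {n : ℤ | s₀ < |a n|}.Finite := by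
    rw [← Set.encard_lt_top_iff]
    have h1 := (h s₀ hs₀ le_rfl).trans_lt ENNReal.ofReal_lt_top
    exact_mod_cast h1
  obtain ⟨M₀, hM₀⟩ := (hfin.image (fun n => |a n|)).bddAbove
  obtain ⟨M, hM, hMs⟩ : ∃ M, (∀ n, |a n| ≤ M) ∧ s₀ ≤ M := by
    refine ⟨max M₀ s₀, fun n => ?_, le_max_right _ _⟩
    by_cases hn : s₀ < |a n|
    · exact (hM₀ ⟨n, hn, rfl⟩).trans (le_max_left _ _)
    · exact (not_lt.1 hn).trans (le_max_right _ _)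
  have hMpos : 0 < M := hs₀.trans_le hMs
  have h1 : 1 ≤ (M / s₀) ^ q := Real.one_le_rpow ((one_le_div hs₀).2 hMs) hq.le
  refine ⟨C' * (M / s₀) ^ q, by positivity, fun s hs => ?_⟩
  by_cases hss : s ≤ s₀
  · refine (h s hs hss).trans (ENNReal.ofReal_le_ofReal ?_)
    gcongr
    exact le_mul_of_one_le_right hC.le h1
  · push Not at hss
    by_cases hsM : s < M
    · have hsub : {n : ℤ | s < |a n|} ⊆ {n : ℤ | s₀ < |a n|} := fun n hn => hss.trans hn
      have h2 : ({n : ℤ | s < |a n|}.encard : ℝ≥0∞) ≤ ({n : ℤ | s₀ < |a n|}.encard : ℝ≥0∞) := by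
        exact_mod_cast Set.encard_le_encard hsub
      refine (h2.trans (h s₀ hs₀ le_rfl)).trans (ENNReal.ofReal_le_ofReal ?_)
      rw [mul_assoc]
      gcongr
      rw [Real.div_rpow hMpos.le hs₀.le, Real.rpow_neg hs₀.le, Real.rpow_neg hs.le]
      have : s ^ q ≤ M ^ q := Real.rpow_le_rpow hs.le hsM.le hq.le
      have h3 : 0 < s ^ q := by positivity
      have h4 : 0 < s₀ ^ q := by positivity
      rw [div_mul_eq_mul_div, inv_eq_one_div]
      gcongr
      rw [← div_eq_mul_inv]
      exact (one_le_div h3).2 this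
    · have : {n : ℤ | s < |a n|} = ∅ := by
        ext n
        simp only [Set.mem_setOf_eq, Set.mem_empty_iff_false, iff_false, not_lt]
        exact (hM n).trans (not_lt.1 hsM)
      rw [this]
      simp

theorem sum_le_of_global (q σ c : ℝ) (hσ : 0 < σ) (hq : σ < q) (hc : 0 < c)
    (a : ℤ → ℝ) (K : ℝ) (hK : 0 < K) (h : ∀ s : ℝ, 0 < s →
        ({n : ℤ | s < |a n|}.encard : ℝ≥0∞) ≤ ENNReal.ofReal (K * s ^ (-q)))
    (α : ℝ) (hα : 0 < α) :
    (∑' n : {n : ℤ // c < α * |a n|}, ENNReal.ofReal ((α * |a n.1|) ^ σ)) ≤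
          ENNReal.ofReal (K * c ^ (σ - q) * 2 ^ (σ + q) * (1 - 2 ^ (σ - q))⁻¹ * α ^ q) := by
  classical
  have hρ : (2:ℝ) ^ (σ - q) < 1 := Real.rpow_lt_one_of_one_lt_of_neg one_lt_two (by linarith)
  have hρ0 : 0 < (2:ℝ) ^ (σ - q) := by positivity
  set w : ℕ → ℝ≥0∞ := fun k => ENNReal.ofReal ((c * 2 ^ (k+1)) ^ σ) with hw
  set S : ℕ → Set ℤ := fun k => {n : ℤ | c * 2 ^ k / 2 / α < |a n|} with hS
  have key : ∀ n : {n : ℤ // c < α * |a n|}, ENNReal.ofReal ((α * |a n.1|) ^ σ) ≤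
      ∑' k : ℕ, (S k).indicator (fun _ => w k) n.1 := by
    rintro ⟨n, hn⟩
    obtain ⟨k, hk1, hk2⟩ := exists_nat_pow_near ((one_le_div hc).2 hn.le) (one_lt_two (α := ℝ))
    rw [le_div_iff₀ hc] at hk1
    rw [div_lt_iff₀ hc] at hk2
    refine le_trans ?_ (ENNReal.le_tsum k)
    have hmem : n ∈ S k := by
      simp only [hS, Set.mem_setOf_eq]
      rw [div_lt_iff₀ hα]
      have : 0 < c * 2 ^ k := by positivity
      linarith
    rw [Set.indicator_of_mem hmem]
    apply ENNReal.ofReal_le_ofReal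
    apply Real.rpow_le_rpow (by positivity) _ hσ.le
    linarith
  calc _ ≤ ∑' n : {n : ℤ // c < α * |a n|}, ∑' k : ℕ, (S k).indicator (fun _ => w k) n.1 :=
        ENNReal.tsum_le_tsum key
    _ ≤ ∑' n : ℤ, ∑' k : ℕ, (S k).indicator (fun _ => w k) n :=
        ENNReal.tsum_comp_le_tsum_of_injective Subtype.val_injective
          (fun n : ℤ => ∑' k : ℕ, (S k).indicator (fun _ => w k) n)
    _ = ∑' k : ℕ, ∑' n : ℤ, (S k).indicator (fun _ => w k) n := ENNReal.tsum_comm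
    _ = ∑' k : ℕ, ((S k).encard : ℝ≥0∞) * w k := by
        congr 1; ext1 k
        rw [← tsum_subtype, ENNReal.tsum_set_const]
    _ ≤ ∑' k : ℕ, ENNReal.ofReal (K * c ^ (σ - q) * 2 ^ (σ + q) * α ^ q * (2 ^ (σ - q)) ^ k) := by
        apply ENNReal.tsum_le_tsum
        intro k
        refine (mul_le_mul_left (h _ (by positivity)) _).trans ?_
        rw [hw, ← ENNReal.ofReal_mul (by positivity)]
        apply ENNReal.ofReal_le_ofReal
        apply le_of_eq
        have e2 : ((2:ℝ) ^ (σ - q)) ^ k = ((2:ℝ)^k) ^ σ / ((2:ℝ)^k) ^ q := by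
          rw [← Real.rpow_sub (by positivity), ← Real.rpow_natCast, ← Real.rpow_mul (by norm_num),
            ← Real.rpow_natCast, ← Real.rpow_mul (by norm_num), mul_comm]
        rw [e2, Real.rpow_neg (by positivity), Real.div_rpow (by positivity) (by positivity),
          Real.div_rpow (by positivity) (by positivity), Real.mul_rpow (by positivity) (by positivity),
          Real.mul_rpow (by positivity) (by positivity), pow_succ,
          Real.mul_rpow (by positivity) (by positivity), Real.rpow_sub hc,
          Real.rpow_add (by norm_num)]
        have : 0 < ((2:ℝ)^k)^q := by positivity
        have : 0 < (2:ℝ)^q := by positivity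
        have : 0 < c^q := by positivity
        have : 0 < α^q := by positivity
        generalize ((2:ℝ)^k)^q = A at *
        generalize ((2:ℝ)^k)^σ = B at *
        field_simp
    _ = _ := by
        rw [← ENNReal.ofReal_tsum_of_nonneg (fun k => by positivity)
          ((summable_geometric_of_lt_one hρ0.le hρ).mul_left _), tsum_mul_left,
          tsum_geometric_of_lt_one hρ0.le hρ]
        congr 1; ring

/-- Equivalence of (8.4) and (8.5) of the paper: for `q > σ > 0` and `c > 0`,
`∑_{α|a_n|>c} (α|a_n|)^σ = O(α^q)` as `α → +∞` if and only if
`card{n : |a_n| > s} = O(s^{−q})` as `s → 0+`. -/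
theorem sum_rpow_bigO_iff_card_bigO (q σ c : ℝ) (hσ : 0 < σ) (hq : σ < q) (hc : 0 < c)
    (a : ℤ → ℝ) :
    (∃ C : ℝ, 0 < C ∧ ∃ α₀ : ℝ, 1 ≤ α₀ ∧ ∀ α : ℝ, α₀ ≤ α →
        (∑' n : {n : ℤ // c < α * |a n|}, ENNReal.ofReal ((α * |a n.1|) ^ σ)) ≤
          ENNReal.ofReal (C * α ^ q)) ↔
    (∃ C' : ℝ, 0 < C' ∧ ∃ s₀ : ℝ, 0 < s₀ ∧ ∀ s : ℝ, 0 < s → s ≤ s₀ →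
        ({n : ℤ | s < |a n|}.encard : ℝ≥0∞) ≤ ENNReal.ofReal (C' * s ^ (-q))) := by
  constructor
  · rintro ⟨C, hC, α₀, hα₀, h⟩
    have hα₀' : 0 < α₀ := by linarith
    refine ⟨C * c ^ q / c ^ σ, by positivity, c / α₀, by positivity, fun s hs hs' => ?_⟩
    have hα : α₀ ≤ c / s := by
      rw [le_div_iff₀ hs]; rw [le_div_iff₀ hα₀'] at hs'; linarith
    have h1 := h _ hα
    have hset : {n : ℤ | s < |a n|} = {n : ℤ | c < c / s * |a n|} := by
      ext n
      simp only [Set.mem_setOf_eq]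
      rw [div_mul_eq_mul_div, lt_div_iff₀ hs, mul_lt_mul_iff_right₀ hc]
    have h2 : ({n : ℤ | s < |a n|}.encard : ℝ≥0∞) * ENNReal.ofReal (c ^ σ) ≤
        ENNReal.ofReal (C * (c / s) ^ q) := by
      refine le_trans ?_ h1
      rw [hset, ← ENNReal.tsum_set_const]
      apply ENNReal.tsum_le_tsum
      rintro ⟨n, hn⟩
      exact ENNReal.ofReal_le_ofReal (Real.rpow_le_rpow hc.le (le_of_lt hn) hσ.le)
    have hcσ : 0 < c ^ σ := by positivity
    rw [← ENNReal.le_div_iff_mul_le (Or.inl (by simpa using hcσ)) (Or.inl ENNReal.ofReal_ne_top),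
      ← ENNReal.ofReal_div_of_pos hcσ] at h2
    refine h2.trans (ENNReal.ofReal_le_ofReal (le_of_eq ?_))
    rw [Real.div_rpow hc.le hs.le, Real.rpow_neg hs.le]
    ring
  · rintro ⟨C', hC', s₀, hs₀, h⟩
    obtain ⟨K, hK, hK'⟩ := card_le_global q (hσ.trans hq) a C' s₀ hC' hs₀ h
    have hρ : (2:ℝ) ^ (σ - q) < 1 := Real.rpow_lt_one_of_one_lt_of_neg one_lt_two (by linarith)
    have : 0 < (1 - (2:ℝ) ^ (σ - q))⁻¹ := inv_pos.2 (by linarith)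
    exact ⟨K * c ^ (σ - q) * 2 ^ (σ + q) * (1 - 2 ^ (σ - q))⁻¹, by positivity, 1, le_rfl,
      fun α hα => sum_le_of_global q σ c hσ hq hc a K hK hK' α (by linarith)⟩
end

section
/- Define the annuli Ω_n := { x ∈ ℝ² : e^n < |x| < e^{n+1} } for n ∈ ℤ. There exists a constant C > 0 such that for every measurable V : ℝ² → [0,∞), ∑_{n=1}^∞ ‖V‖_{B,Ω_n} ≤ C · ( ‖V‖_{B, {|x| > e}} + ∫_{|x| > e} V(x)·log(log|x|) dx ), all quantities interpreted in [0,∞]. -/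
open MeasureTheory ENNReal

/-- The annulus `Ω_n = {x ∈ ℝ² : eⁿ < |x| < e^{n+1}}`. -/
def annulusOmega (n : ℤ) : Set (EuclideanSpace ℝ (Fin 2)) :=
  {x | Real.exp n < ‖x‖ ∧ ‖x‖ < Real.exp (n + 1)}

/-- The Orlicz norm `‖V‖_{B,Ω}` of a nonnegative `V` on a set `Ω ⊆ ℝ²`, given by duality
against nonnegative measurable `g` with `∫_Ω (e^g − 1 − g) dx ≤ 1`. -/
noncomputable def orliczNormB (Ω : Set (EuclideanSpace ℝ (Fin 2)))
    (V : EuclideanSpace ℝ (Fin 2) → ℝ) : ℝ≥0∞ :=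
  sSup {r : ℝ≥0∞ | ∃ g : EuclideanSpace ℝ (Fin 2) → NNReal, Measurable g ∧
    (∫⁻ x in Ω, ENNReal.ofReal (Real.exp (g x) - 1 - (g x : ℝ))) ≤ 1 ∧
    r = ∫⁻ x in Ω, ENNReal.ofReal (V x) * (g x : ℝ≥0∞)}

theorem aux_shift (g s : ℝ) (hs : 0 ≤ s) (hg : 0 ≤ g) :
    Real.exp (max (g - s) 0 / 2) - 1 - max (g - s) 0 / 2 ≤
      (Real.exp (-s) / 2) * (Real.exp g - 1 - g) := by
  have hA : 0 ≤ Real.exp g - 1 - g := by linarith [Real.add_one_le_exp g]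
  rcases le_total g s with h | h
  · rw [max_eq_right (by linarith)]
    simp only [zero_div, Real.exp_zero]
    have := mul_nonneg (by positivity : 0 ≤ Real.exp (-s) / 2) hA
    linarith
  · rw [max_eq_left (by linarith)]
    obtain ⟨t, ht⟩ : ∃ t, t = g - s := ⟨_, rfl⟩
    have ht0 : 0 ≤ t := by linarith
    rw [← ht]
    have hgt : g = s + t := by linarith
    have h1 : Real.exp t = Real.exp (t / 2) ^ 2 := by
      rw [← Real.exp_nat_mul]; congr 1; push_cast; ring
    have h2 : Real.exp (-s) * Real.exp g = Real.exp t := by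
      rw [← Real.exp_add]; congr 1; linarith
    have h3 : Real.exp (-s) * (1 + g) ≤ 1 + t := by
      have : 1 + g ≤ Real.exp s * (1 + t) := by
        nlinarith [Real.add_one_le_exp s]
      calc Real.exp (-s) * (1 + g) ≤ Real.exp (-s) * (Real.exp s * (1 + t)) := by gcongr
        _ = 1 + t := by rw [← mul_assoc, ← Real.exp_add]; simp
    nlinarith [sq_nonneg (Real.exp (t / 2) - 1)]

theorem aux_sum : (∑' n : ℕ, ENNReal.ofReal (1 / (n + 1 : ℝ) ^ 2 / 2)) ≤ 1 := by
  have h0 : HasSum (fun n : ℕ => 1 / ((n : ℝ) + 1) ^ 2) (Real.pi ^ 2 / 6) := by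
    have h := (hasSum_nat_add_iff' (f := fun n : ℕ => 1 / (n : ℝ) ^ 2) 1).2 hasSum_zeta_two
    simpa using h
  have h1 := h0.div_const 2
  rw [← ENNReal.ofReal_tsum_of_nonneg (fun n => by positivity) h1.summable, h1.tsum_eq]
  rw [ENNReal.ofReal_le_one]
  nlinarith [Real.pi_lt_d2, Real.pi_pos]

theorem aux_log {n : ℕ} {x : EuclideanSpace ℝ (Fin 2)} (hx : x ∈ annulusOmega (n + 1)) :
    (n + 1 : ℝ) < Real.log ‖x‖ ∧ Real.log ‖x‖ < n + 2 := by
  obtain ⟨h1, h2⟩ := hx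
  push_cast at h1 h2
  have h0 : 0 < ‖x‖ := (Real.exp_pos _).trans h1
  refine ⟨(Real.lt_log_iff_exp_lt h0).2 h1, (Real.log_lt_iff_lt_exp h0).2 ?_⟩
  convert h2 using 2; ring

theorem aux_floor {n : ℕ} {x : EuclideanSpace ℝ (Fin 2)} (hx : x ∈ annulusOmega (n + 1)) :
    ⌊Real.log ‖x‖⌋₊ - 1 = n := by
  obtain ⟨h1, h2⟩ := aux_log hx
  have : ⌊Real.log ‖x‖⌋₊ = n + 1 := by
    rw [Nat.floor_eq_iff (by linarith [(Nat.cast_nonneg n : (0 : ℝ) ≤ n)])]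
    push_cast
    constructor <;> linarith
  omega

theorem aux_meas (n : ℤ) : MeasurableSet (annulusOmega n) := by
  unfold annulusOmega
  exact (measurableSet_lt measurable_const measurable_norm).inter
    (measurableSet_lt measurable_norm measurable_const)

theorem aux_main (V : EuclideanSpace ℝ (Fin 2) → ℝ) (hV : Measurable V) (hV0 : ∀ x, 0 ≤ V x)
    (g : ℕ → EuclideanSpace ℝ (Fin 2) → NNReal) (hg : ∀ n, Measurable (g n))
    (hgA : ∀ n : ℕ, (∫⁻ x in annulusOmega (n + 1),
      ENNReal.ofReal (Real.exp (g n x) - 1 - (g n x : ℝ))) ≤ 1) :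
    (∑' n : ℕ, ∫⁻ x in annulusOmega (n + 1), ENNReal.ofReal (V x) * (g n x : ℝ≥0∞)) ≤
        ENNReal.ofReal 2 *
          (orliczNormB {x | Real.exp 1 < ‖x‖} V +
            ∫⁻ x in {x : EuclideanSpace ℝ (Fin 2) | Real.exp 1 < ‖x‖},
              ENNReal.ofReal (V x * Real.log (Real.log ‖x‖))) := by
  set U : Set (EuclideanSpace ℝ (Fin 2)) := ⋃ n : ℕ, annulusOmega (n + 1) with hU
  have hmU : MeasurableSet U := MeasurableSet.iUnion fun n => aux_meas _
  have hdisj : Pairwise (Function.onFun Disjoint fun n : ℕ => annulusOmega (n + 1)) := by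
    intro m n hmn
    refine Set.disjoint_left.2 fun x hm hn => hmn ?_
    rw [← aux_floor hm, ← aux_floor hn]
  set S : Set (EuclideanSpace ℝ (Fin 2)) := {x | Real.exp 1 < ‖x‖} with hS
  have hmS : MeasurableSet S := measurableSet_lt measurable_const measurable_norm
  have hUS : U ⊆ S := by
    refine Set.iUnion_subset fun n x hx => ?_
    refine lt_of_le_of_lt ?_ hx.1
    apply Real.exp_le_exp.2
    push_cast
    linarith [(Nat.cast_nonneg n : (0 : ℝ) ≤ n)]
  let k : ℕ → EuclideanSpace ℝ (Fin 2) → NNReal := fun n x =>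
    Real.toNNReal (max ((g n x : ℝ) - 2 * Real.log (n + 1)) 0 / 2)
  have hk : ∀ n, Measurable (k n) := fun n => by
    have := hg n
    fun_prop
  have hkv : ∀ n x, (k n x : ℝ) = max ((g n x : ℝ) - 2 * Real.log (n + 1)) 0 / 2 := fun n x =>
    Real.coe_toNNReal _ (by positivity)
  let N : EuclideanSpace ℝ (Fin 2) → ℕ := fun x => ⌊Real.log ‖x‖⌋₊ - 1
  have hN : Measurable N := by
    have : Measurable fun x : EuclideanSpace ℝ (Fin 2) => ⌊Real.log ‖x‖⌋₊ :=
      (Real.measurable_log.comp measurable_norm).nat_floor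
    exact (measurable_from_nat (f := fun n : ℕ => n - 1)).comp this
  let h : EuclideanSpace ℝ (Fin 2) → NNReal := U.indicator fun x => k (N x) x
  have hh : Measurable h := by
    refine Measurable.indicator ?_ hmU
    have : Measurable (fun p : EuclideanSpace ℝ (Fin 2) × ℕ => k p.2 p.1) :=
      measurable_from_prod_countable_left fun n => hk n
    exact this.comp (measurable_id.prodMk hN)
  have hhk : ∀ n : ℕ, ∀ x ∈ annulusOmega (n + 1), h x = k n x := by
    intro n x hx
    have : x ∈ U := Set.mem_iUnion.2 ⟨n, hx⟩
    simp only [h, Set.indicator_of_mem this, N, aux_floor hx]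
  have hhA : (∫⁻ x in S, ENNReal.ofReal (Real.exp (h x) - 1 - (h x : ℝ))) ≤ 1 := by
    have e1 : (∫⁻ x in S, ENNReal.ofReal (Real.exp (h x) - 1 - (h x : ℝ)))
        = ∫⁻ x in U, ENNReal.ofReal (Real.exp (h x) - 1 - (h x : ℝ)) := by
      have e0 : (fun x => ENNReal.ofReal (Real.exp (h x) - 1 - (h x : ℝ))) =
          U.indicator (fun x => ENNReal.ofReal (Real.exp (h x) - 1 - (h x : ℝ))) := by
        symm
        rw [Set.indicator_eq_self]
        intro x hx
        by_contra hxU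
        exact hx (by simp [h, Set.indicator_of_notMem hxU])
      conv_lhs => rw [e0]
      rw [setLIntegral_indicator hmU, Set.inter_eq_left.2 hUS]
    rw [e1, hU, lintegral_iUnion (fun n => aux_meas _) hdisj]
    refine le_trans (ENNReal.tsum_le_tsum fun n => ?_) aux_sum
    calc (∫⁻ x in annulusOmega (n + 1), ENNReal.ofReal (Real.exp (h x) - 1 - (h x : ℝ)))
        ≤ ∫⁻ x in annulusOmega (n + 1), ENNReal.ofReal (1 / (n + 1 : ℝ) ^ 2 / 2) *
            ENNReal.ofReal (Real.exp (g n x) - 1 - (g n x : ℝ)) := by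
          refine setLIntegral_mono' (aux_meas _) fun x hx => ?_
          rw [hhk n x hx, hkv, ← ENNReal.ofReal_mul (by positivity)]
          apply ENNReal.ofReal_le_ofReal
          have := aux_shift (g n x) (2 * Real.log (n + 1))
            (mul_nonneg zero_le_two (Real.log_nonneg (by linarith [(Nat.cast_nonneg n : (0 : ℝ) ≤ n)])))
            (g n x).2
          have e : Real.exp (-(2 * Real.log (n + 1))) = 1 / (n + 1 : ℝ) ^ 2 := by
            rw [Real.exp_neg, mul_comm, Real.exp_mul, Real.exp_log (by positivity), one_div]
            norm_num
          rwa [e] at this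
      _ = ENNReal.ofReal (1 / (n + 1 : ℝ) ^ 2 / 2) * ∫⁻ x in annulusOmega (n + 1),
            ENNReal.ofReal (Real.exp (g n x) - 1 - (g n x : ℝ)) :=
          lintegral_const_mul' _ _ ENNReal.ofReal_ne_top
      _ ≤ _ := mul_le_of_le_one_right' (hgA n)
  have hnorm : (∫⁻ x in S, ENNReal.ofReal (V x) * (h x : ℝ≥0∞)) ≤ orliczNormB S V :=
    le_sSup ⟨h, hh, hhA, rfl⟩
  calc (∑' n : ℕ, ∫⁻ x in annulusOmega (n + 1), ENNReal.ofReal (V x) * (g n x : ℝ≥0∞))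
      ≤ ∑' n : ℕ, ∫⁻ x in annulusOmega (n + 1), ENNReal.ofReal 2 *
          (ENNReal.ofReal (V x) * (h x : ℝ≥0∞) +
            ENNReal.ofReal (V x * Real.log (Real.log ‖x‖))) := by
        refine ENNReal.tsum_le_tsum fun n => setLIntegral_mono' (aux_meas _) fun x hx => ?_
        have hn : (0 : ℝ) ≤ n := Nat.cast_nonneg n
        have hlog : Real.log (n + 1) ≤ Real.log (Real.log ‖x‖) :=
          Real.log_le_log (by positivity) (aux_log hx).1.le
        have hlog0 : 0 ≤ Real.log ((n : ℝ) + 1) := Real.log_nonneg (by linarith)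
        rw [hhk n x hx, ← ENNReal.ofReal_coe_nnreal, ← ENNReal.ofReal_coe_nnreal,
          ← ENNReal.ofReal_mul (hV0 x), ← ENNReal.ofReal_mul (hV0 x),
          ← ENNReal.ofReal_add (mul_nonneg (hV0 x) (NNReal.coe_nonneg (k n x)))
            (mul_nonneg (hV0 x) (hlog0.trans hlog)), ← ENNReal.ofReal_mul zero_le_two]
        apply ENNReal.ofReal_le_ofReal
        have hle : (g n x : ℝ) ≤ 2 * ((k n x : ℝ) + Real.log (Real.log ‖x‖)) := by
          rw [hkv]
          linarith [le_max_left ((g n x : ℝ) - 2 * Real.log (n + 1)) 0]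
        calc V x * (g n x : ℝ) ≤ V x * (2 * ((k n x : ℝ) + Real.log (Real.log ‖x‖))) :=
              mul_le_mul_of_nonneg_left hle (hV0 x)
          _ = _ := by ring
    _ = ∫⁻ x in U, ENNReal.ofReal 2 * (ENNReal.ofReal (V x) * (h x : ℝ≥0∞) +
            ENNReal.ofReal (V x * Real.log (Real.log ‖x‖))) := by
        rw [hU, lintegral_iUnion (fun n => aux_meas _) hdisj]
    _ ≤ ∫⁻ x in S, ENNReal.ofReal 2 * (ENNReal.ofReal (V x) * (h x : ℝ≥0∞) +
            ENNReal.ofReal (V x * Real.log (Real.log ‖x‖))) := lintegral_mono_set hUS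
    _ = ENNReal.ofReal 2 * ((∫⁻ x in S, ENNReal.ofReal (V x) * (h x : ℝ≥0∞)) +
          ∫⁻ x in S, ENNReal.ofReal (V x * Real.log (Real.log ‖x‖))) := by
        rw [lintegral_const_mul' _ _ ENNReal.ofReal_ne_top, lintegral_add_left]
        exact hV.ennreal_ofReal.mul hh.coe_nnreal_ennreal
    _ ≤ _ := by gcongr

theorem aux_tsum (s : ℕ → Set ℝ≥0∞) (hs : ∀ n, (s n).Nonempty) (R : ℝ≥0∞)
    (H : ∀ f : ℕ → ℝ≥0∞, (∀ n, f n ∈ s n) → ∑' n, f n ≤ R) : ∑' n, sSup (s n) ≤ R := by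
  have hseq : ∀ n, ∃ u : ℕ → ℝ≥0∞, Monotone u ∧
      Filter.Tendsto u Filter.atTop (nhds (sSup (s n))) ∧ ∀ m, u m ∈ s n := fun n =>
    exists_seq_tendsto_sSup (hs n) (OrderTop.bddAbove _)
  choose u hu1 hu2 hu3 using hseq
  rw [ENNReal.tsum_eq_iSup_sum]
  refine iSup_le fun F => ?_
  refine le_of_tendsto (tendsto_finsetSum F fun n _ => hu2 n) (Filter.Eventually.of_forall ?_)
  intro m
  exact (ENNReal.sum_le_tsum F).trans (H (fun n => u n m) fun n => hu3 n m)

/-- Lemma `reversetr`: there is a constant `C > 0` such that for all measurable `V ≥ 0`,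
`∑_{n≥1} ‖V‖_{B,Ω_n} ≤ C·(‖V‖_{B,{|x|>e}} + ∫_{|x|>e} V(x)·log log|x| dx)`. -/
theorem sum_orliczB_annuli_le : ∃ C : ℝ, 0 < C ∧
    ∀ V : EuclideanSpace ℝ (Fin 2) → ℝ, Measurable V → (∀ x, 0 ≤ V x) →
      (∑' n : ℕ, orliczNormB (annulusOmega (n + 1)) V) ≤
        ENNReal.ofReal C *
          (orliczNormB {x | Real.exp 1 < ‖x‖} V +
            ∫⁻ x in {x : EuclideanSpace ℝ (Fin 2) | Real.exp 1 < ‖x‖},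
              ENNReal.ofReal (V x * Real.log (Real.log ‖x‖))) := by
  refine ⟨2, two_pos, fun V hV hV0 => ?_⟩
  unfold orliczNormB
  apply aux_tsum
  · intro n
    exact ⟨_, fun _ => 0, measurable_const, by simp, rfl⟩
  intro f hf
  choose g hg hgA hgf using hf
  simp_rw [hgf]
  exact aux_main V hV hV0 g hg hgA
end

section
/- Let 0 < a < b, κ > 0, and set C(κ) := (1/(2κ)) · ( 1 + √(1+4κ) · (b^{√(1+4κ)} + a^{√(1+4κ)}) / (b^{√(1+4κ)} − a^{√(1+4κ)}) ). Let v : ℝ → ℝ be measurable with ∫_a^b v(t)² dt < ∞ and let u : ℝ → ℝ satisfy u(t) = u(a) + ∫_a^t v(s) ds for all t ∈ [a,b]. Then for every x ∈ [a,b], u(x)²/x ≤ C(κ) · ( ∫_a^b v(t)² dt + κ·∫_a^b u(t)²/t² dt ). -/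
open MeasureTheory intervalIntegral

/-- The Riccati function vanishing at `c`. -/
noncomputable def hsG (κ s c t : ℝ) : ℝ :=
  2 * κ * (t ^ s - c ^ s) / (t * ((s - 1) * t ^ s + (s + 1) * c ^ s))

lemma hsG_den_pos {s c t : ℝ} (hs : 1 < s) (hc : 0 < c) (ht : 0 < t) :
    0 < t * ((s - 1) * t ^ s + (s + 1) * c ^ s) := by
  have h1 : 0 < t ^ s := Real.rpow_pos_of_pos ht s
  have h2 : 0 < c ^ s := Real.rpow_pos_of_pos hc s
  have h3 : 0 < s - 1 := by linarith
  have h4 : 0 < s + 1 := by linarith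
  positivity

lemma hsG_contDiffOn {κ s c p q : ℝ} (hs : 1 < s) (hc : 0 < c) (hp : 0 < p) (hpq : p ≤ q) :
    ContDiffOn ℝ 1 (hsG κ s c) (Set.uIcc p q) := by
  rw [Set.uIcc_of_le hpq]
  have h : ContDiffOn ℝ 1 (fun t : ℝ => t ^ s) (Set.Icc p q) :=
    contDiffOn_id.rpow_const_of_ne (fun x hx => (hp.trans_le hx.1).ne')
  unfold hsG
  refine ContDiffOn.div ?_ ?_ ?_
  · exact contDiffOn_const.mul (h.sub contDiffOn_const)
  · exact contDiffOn_id.mul ((contDiffOn_const.mul h).add contDiffOn_const)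
  · intro x hx
    exact (hsG_den_pos hs hc (hp.trans_le hx.1)).ne'

lemma hsG_hasDerivAt {κ s c t : ℝ} (hs : 1 < s) (hκ : s ^ 2 = 1 + 4 * κ) (hc : 0 < c)
    (ht : 0 < t) : HasDerivAt (hsG κ s c) (κ / t ^ 2 - hsG κ s c t ^ 2) t := by
  have h : HasDerivAt (fun t : ℝ => t ^ s) (s * t ^ (s - 1)) t :=
    Real.hasDerivAt_rpow_const (Or.inl ht.ne')
  have hd := hsG_den_pos hs hc ht
  have hd2 : (s - 1) * t ^ s + (s + 1) * c ^ s ≠ 0 := fun h0 => by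
    rw [h0] at hd; simp at hd
  have h2 := ((h.sub_const (c ^ s)).const_mul (2 * κ)).div
    ((hasDerivAt_id t).mul ((h.const_mul (s - 1)).add_const ((s + 1) * c ^ s))) hd.ne'
  refine (h2.congr_deriv ?_)
  have hk : κ = (s ^ 2 - 1) / 4 := by linarith
  have e : t ^ (s - 1) = t ^ s / t := Real.rpow_sub_one ht.ne' s
  simp only [id, hsG, Pi.mul_apply]
  rw [e]
  generalize t ^ s = X at *
  generalize c ^ s = A at *
  have ht' := ht.ne'
  clear h2 h e hd
  obtain ⟨D, hD⟩ : ∃ D, D = (s - 1) * X + (s + 1) * A := ⟨_, rfl⟩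
  rw [← hD] at hd2 ⊢
  rw [hk]
  field_simp
  rw [hD]
  ring

lemma hs_energy {κ c d : ℝ} (hc : 0 < c) (hcd : c ≤ d) {U v g : ℝ → ℝ}
    (hU : AbsolutelyContinuousOnInterval U c d) (hg : AbsolutelyContinuousOnInterval g c d)
    (hUv : ∀ᵐ t, t ∈ Set.Icc c d → HasDerivAt U (v t) t)
    (hgd : ∀ t ∈ Set.Icc c d, HasDerivAt g (κ / t ^ 2 - g t ^ 2) t)
    (hv2 : IntervalIntegrable (fun t => v t ^ 2) volume c d) :
    g d * U d ^ 2 - g c * U c ^ 2 ≤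
      (∫ t in c..d, v t ^ 2) + κ * ∫ t in c..d, U t ^ 2 / t ^ 2 := by
  have hW : AbsolutelyContinuousOnInterval (fun t => g t * (U t * U t)) c d :=
    hg.fun_mul (hU.fun_mul hU)
  have hI := hW.integral_deriv_eq_sub
  have hUi : IntervalIntegrable (fun t => U t ^ 2 / t ^ 2) volume c d := by
    apply ContinuousOn.intervalIntegrable
    refine (hU.continuousOn.pow 2).div (by fun_prop) ?_
    intro x hx
    rw [Set.uIcc_of_le hcd] at hx
    exact pow_ne_zero 2 (hc.trans_le hx.1).ne'
  have : (∫ t in c..d, v t ^ 2) + κ * (∫ t in c..d, U t ^ 2 / t ^ 2)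
      = ∫ t in c..d, (v t ^ 2 + κ * (U t ^ 2 / t ^ 2)) := by
    rw [intervalIntegral.integral_add hv2 (hUi.const_mul κ), intervalIntegral.integral_const_mul]
  rw [this]
  have e : g d * U d ^ 2 - g c * U c ^ 2 = ∫ t in c..d, deriv (fun t => g t * (U t * U t)) t := by
    rw [hI]; ring
  rw [e]
  apply intervalIntegral.integral_mono_ae_restrict hcd hW.intervalIntegrable_deriv
    (hv2.add (hUi.const_mul κ))
  rw [Filter.EventuallyLE, ae_restrict_iff' measurableSet_Icc]
  filter_upwards [hUv] with t h1 h2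
  have h3 := (hgd t h2).fun_mul ((h1 h2).fun_mul (h1 h2))
  rw [h3.deriv]
  have : v t ^ 2 + κ * (U t ^ 2 / t ^ 2) - ((κ / t ^ 2 - g t ^ 2) * (U t * U t)
    + g t * (v t * U t + U t * v t)) = (v t - g t * U t) ^ 2 := by ring
  nlinarith [sq_nonneg (v t - g t * U t)]

lemma hs_alg {κ s A B X x : ℝ} (hκ : 0 < κ) (hs : 1 < s) (hA : 0 < A) (hAB : A < B)
    (hAX : A ≤ X) (hXB : X ≤ B) (hx : 0 < x) :
    1 / x ≤ (1 / (2 * κ)) * (1 + s * (B + A) / (B - A)) *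
      (2 * κ * (X - A) / (x * ((s - 1) * X + (s + 1) * A))
        - 2 * κ * (X - B) / (x * ((s - 1) * X + (s + 1) * B))) := by
  have hX : 0 < X := by linarith
  have hB : 0 < B := by linarith
  have h3 : 0 < s - 1 := by linarith
  have h4 : 0 < s + 1 := by linarith
  have hBA : 0 < B - A := by linarith
  have hDa : 0 < (s - 1) * X + (s + 1) * A := by positivity
  have hDb : 0 < (s - 1) * X + (s + 1) * B := by positivity
  have e : (1 / (2 * κ)) * (1 + s * (B + A) / (B - A)) *
      (2 * κ * (X - A) / (x * ((s - 1) * X + (s + 1) * A))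
        - 2 * κ * (X - B) / (x * ((s - 1) * X + (s + 1) * B))) - 1 / x =
      (X - A) * ((s + 1) ^ 2 * B - (s - 1) ^ 2 * X) /
        (x * (((s - 1) * X + (s + 1) * A) * ((s - 1) * X + (s + 1) * B))) := by
    field_simp
    ring
  have hn : 0 ≤ (s + 1) ^ 2 * B - (s - 1) ^ 2 * X := by
    nlinarith [mul_le_mul_of_nonneg_left hXB (sq_nonneg (s - 1)), mul_pos hB h4, mul_pos hB h3]
  have : 0 ≤ (X - A) * ((s + 1) ^ 2 * B - (s - 1) ^ 2 * X) /
        (x * (((s - 1) * X + (s + 1) * A) * ((s - 1) * X + (s + 1) * B))) := by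
    have : 0 ≤ X - A := by linarith
    positivity
  linarith

/-- The sharp one-dimensional Hardy–Sobolev type inequality of Appendix A
(Lemma `1dHSobLem`): for `0 < a < b`, `κ > 0`, and `u ∈ W¹₂([a,b])` with derivative `v`,
`u(x)²/x ≤ C(κ)·(∫_a^b v² dt + κ·∫_a^b u²/t² dt)` for all `x ∈ [a,b]`, where
`C(κ) = (1/(2κ))·(1 + √(1+4κ)·(b^√(1+4κ) + a^√(1+4κ))/(b^√(1+4κ) − a^√(1+4κ)))`. -/
theorem hardy_sobolev_interval (a b κ : ℝ) (ha : 0 < a) (hab : a < b) (hκ : 0 < κ)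
    (v : ℝ → ℝ) (hv : Measurable v)
    (hv2 : IntervalIntegrable (fun t => v t ^ 2) volume a b)
    (u : ℝ → ℝ) (hu : ∀ t ∈ Set.Icc a b, u t = u a + ∫ s in a..t, v s) :
    ∀ x ∈ Set.Icc a b,
      u x ^ 2 / x ≤
        (1 / (2 * κ)) *
            (1 + Real.sqrt (1 + 4 * κ) *
              (b ^ Real.sqrt (1 + 4 * κ) + a ^ Real.sqrt (1 + 4 * κ)) /
              (b ^ Real.sqrt (1 + 4 * κ) - a ^ Real.sqrt (1 + 4 * κ))) *
          ((∫ t in a..b, v t ^ 2) + κ * ∫ t in a..b, u t ^ 2 / t ^ 2) := by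
  intro x hx
  obtain ⟨s, hsdef⟩ : ∃ s, s = Real.sqrt (1 + 4 * κ) := ⟨_, rfl⟩
  rw [← hsdef]
  have hsq : s ^ 2 = 1 + 4 * κ := by rw [hsdef]; exact Real.sq_sqrt (by linarith)
  have hs0 : 0 ≤ s := by rw [hsdef]; exact Real.sqrt_nonneg _
  have hs : 1 < s := by nlinarith
  have hb : 0 < b := ha.trans hab
  have hx0 : 0 < x := ha.trans_le hx.1
  have hvi : IntervalIntegrable v volume a b := by
    refine IntervalIntegrable.mono_fun (g := v) (f := fun t => 1 + v t ^ 2)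
      (intervalIntegrable_const.add hv2) hv.aestronglyMeasurable ?_
    refine Filter.Eventually.of_forall fun t => ?_
    simp only [Real.norm_eq_abs]
    rw [abs_of_nonneg (by positivity : 0 ≤ 1 + v t ^ 2)]
    nlinarith [sq_nonneg (|v t| - 1), sq_abs (v t), abs_nonneg (v t)]
  obtain ⟨U, hUdef⟩ : ∃ U : ℝ → ℝ, U = fun t => u a + ∫ s in a..t, v s := ⟨_, rfl⟩
  have huU : ∀ t ∈ Set.Icc a b, u t = U t := fun t ht => by rw [hu t ht, hUdef]
  have hI : (∫ t in a..b, u t ^ 2 / t ^ 2) = ∫ t in a..b, U t ^ 2 / t ^ 2 := by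
    apply intervalIntegral.integral_congr
    intro t ht
    rw [Set.uIcc_of_le hab.le] at ht
    simp only [huU t ht]
  rw [hI, huU x hx]
  have hUac : AbsolutelyContinuousOnInterval U a b := by
    rw [hUdef]
    have h1 : AbsolutelyContinuousOnInterval (fun _ : ℝ => u a) a b :=
      ContDiffOn.absolutelyContinuousOnInterval contDiffOn_const
    exact h1.fun_add (hvi.absolutelyContinuousOnInterval_intervalIntegral (by simp))
  have hUd : ∀ᵐ t, t ∈ Set.Icc a b → HasDerivAt U (v t) t := by
    filter_upwards [hvi.ae_hasDerivAt_integral] with t h1 h2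
    rw [hUdef]
    exact (h1 (by rwa [Set.uIcc_of_le hab.le]) a (by simp)).const_add (u a)
  have hxm : x ∈ Set.uIcc a b := by rwa [Set.uIcc_of_le hab.le]
  have s1 : Set.uIcc a x ⊆ Set.uIcc a b := Set.uIcc_subset_uIcc_left hxm
  have s2 : Set.uIcc x b ⊆ Set.uIcc a b := Set.uIcc_subset_uIcc_right hxm
  have hUi : IntervalIntegrable (fun t => U t ^ 2 / t ^ 2) volume a b := by
    apply ContinuousOn.intervalIntegrable
    refine (hUac.continuousOn.pow 2).div (by fun_prop) ?_
    intro x hx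
    rw [Set.uIcc_of_le hab.le] at hx
    exact pow_ne_zero 2 (ha.trans_le hx.1).ne'
  have E1 := hs_energy (κ := κ) ha hx.1 (hUac.mono s1)
    (hsG_contDiffOn (κ := κ) hs ha ha hx.1).absolutelyContinuousOnInterval
    (by filter_upwards [hUd] with t h1 h2; exact h1 ⟨h2.1, h2.2.trans hx.2⟩)
    (fun t ht => hsG_hasDerivAt hs hsq ha (ha.trans_le ht.1)) (hv2.mono_set s1)
  have E2 := hs_energy (κ := κ) hx0 hx.2 (hUac.mono s2)
    (hsG_contDiffOn (κ := κ) hs hb hx0 hx.2).absolutelyContinuousOnInterval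
    (by filter_upwards [hUd] with t h1 h2; exact h1 ⟨hx.1.trans h2.1, h2.2⟩)
    (fun t ht => hsG_hasDerivAt hs hsq hb (hx0.trans_le ht.1)) (hv2.mono_set s2)
  have z1 : hsG κ s a a = 0 := by simp [hsG]
  have z2 : hsG κ s b b = 0 := by simp [hsG]
  rw [z1] at E1
  rw [z2] at E2
  rw [← intervalIntegral.integral_add_adjacent_intervals (hv2.mono_set s1) (hv2.mono_set s2),
    ← intervalIntegral.integral_add_adjacent_intervals (hUi.mono_set s1) (hUi.mono_set s2)]
  have hA : 0 < a ^ s := Real.rpow_pos_of_pos ha s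
  have hAB : a ^ s < b ^ s := Real.rpow_lt_rpow ha.le hab (by linarith)
  have hC := hs_alg hκ hs hA hAB (Real.rpow_le_rpow ha.le hx.1 hs0)
    (Real.rpow_le_rpow hx0.le hx.2 hs0) hx0
  have hC0 : 0 ≤ (1 / (2 * κ)) * (1 + s * (b ^ s + a ^ s) / (b ^ s - a ^ s)) := by
    have : 0 < b ^ s - a ^ s := by linarith
    have : 0 < b ^ s := by linarith
    positivity
  change 1 / x ≤ (1 / (2 * κ)) * (1 + s * (b ^ s + a ^ s) / (b ^ s - a ^ s)) *
    (hsG κ s a x - hsG κ s b x) at hC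
  calc U x ^ 2 / x = 1 / x * U x ^ 2 := by ring
    _ ≤ (1 / (2 * κ)) * (1 + s * (b ^ s + a ^ s) / (b ^ s - a ^ s)) *
      (hsG κ s a x - hsG κ s b x) * U x ^ 2 := mul_le_mul_of_nonneg_right hC (sq_nonneg _)
    _ = (1 / (2 * κ)) * (1 + s * (b ^ s + a ^ s) / (b ^ s - a ^ s)) *
      ((hsG κ s a x - hsG κ s b x) * U x ^ 2) := by ring
    _ ≤ _ := mul_le_mul_of_nonneg_left (by nlinarith) hC0
end

section
/- Let a < b and ρ > 0. Let v : ℝ → ℝ be measurable with ∫_a^b v(t)² dt < ∞ and let u : ℝ → ℝ satisfy u(t) = u(a) + ∫_a^t v(s) ds for all t ∈ [a,b]. Then for every x ∈ [a,b], u(x)² ≤ coth(ρ) · ( ((b−a)/ρ)·∫_a^b v(t)² dt + (ρ/(b−a))·∫_a^b u(t)² dt ). -/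
open MeasureTheory intervalIntegral

theorem aux_hasDeriv (k m t : ℝ) :
    HasDerivAt (fun t => Real.sinh (k * (t - m)) / Real.cosh (k * (t - m)))
      (k * (1 - (Real.sinh (k * (t - m)) / Real.cosh (k * (t - m))) ^ 2)) t := by
  have h0 : HasDerivAt (fun t : ℝ => k * (t - m)) k t := by
    simpa using ((hasDerivAt_id t).sub_const m).const_mul k
  have hc := (Real.cosh_pos (k * (t - m))).ne'
  convert! h0.sinh.div h0.cosh hc using 1
  field_simp

theorem aux_piece (k m c d : ℝ) (hk : 0 < k) (hcd : c ≤ d) (v U : ℝ → ℝ)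
    (hv2 : IntervalIntegrable (fun t => v t ^ 2) volume c d)
    (hU : AbsolutelyContinuousOnInterval U c d)
    (hUv : ∀ᵐ t, t ∈ Set.Icc c d → HasDerivAt U (v t) t) :
    (Real.sinh (k * (d - m)) / Real.cosh (k * (d - m))) * U d ^ 2
      - (Real.sinh (k * (c - m)) / Real.cosh (k * (c - m))) * U c ^ 2
      ≤ ∫ t in c..d, (k⁻¹ * v t ^ 2 + k * U t ^ 2) := by
  set w : ℝ → ℝ := fun t => Real.sinh (k * (t - m)) / Real.cosh (k * (t - m)) with hw
  have hwc : ContDiff ℝ 1 w := by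
    refine ContDiff.div ?_ ?_ (fun t => (Real.cosh_pos _).ne')
    · exact Real.contDiff_sinh.comp (by fun_prop)
    · exact Real.contDiff_cosh.comp (by fun_prop)
  have hwac : AbsolutelyContinuousOnInterval w c d :=
    hwc.contDiffOn.absolutelyContinuousOnInterval
  have hF : AbsolutelyContinuousOnInterval (fun t => w t * (U t * U t)) c d :=
    hwac.fun_mul (hU.fun_mul hU)
  have h1 := hF.integral_deriv_eq_sub
  have hUc := hU.continuousOn
  have hint : IntervalIntegrable (fun t => k⁻¹ * v t ^ 2 + k * U t ^ 2) volume c d :=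
    (hv2.const_mul _).add ((hUc.pow 2).intervalIntegrable.const_mul _)
  calc _ = ∫ t in c..d, deriv (fun t => w t * (U t * U t)) t := by
        rw [h1]; simp only [hw]; ring
    _ ≤ _ := by
        refine intervalIntegral.integral_mono_ae_restrict hcd hF.intervalIntegrable_deriv hint ?_
        rw [Filter.EventuallyLE, ae_restrict_iff' measurableSet_Icc]
        filter_upwards [hUv] with t ht htm
        have hd := (aux_hasDeriv k m t).mul ((ht htm).mul (ht htm))
        have : deriv (fun t => w t * (U t * U t)) t
          = k * (1 - w t ^ 2) * (U t * U t) + w t * (v t * U t + U t * v t) := hd.deriv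
        rw [this]
        have hsq : 0 ≤ k⁻¹ * (v t - k * w t * U t) ^ 2 := by positivity
        have e : k⁻¹ * (v t - k * w t * U t) ^ 2
          = k⁻¹ * v t ^ 2 - 2 * w t * U t * v t + k * w t ^ 2 * U t ^ 2 := by
          field_simp
          ring
        linarith

theorem aux_tanh (p q : ℝ) (hp : 0 ≤ p) (hq : 0 ≤ q) :
    Real.sinh (p + q) / Real.cosh (p + q)
      ≤ Real.sinh p / Real.cosh p + Real.sinh q / Real.cosh q := by
  have hcp := Real.cosh_pos p
  have hcq := Real.cosh_pos q
  have hsp := Real.sinh_nonneg_iff.2 hp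
  have hsq := Real.sinh_nonneg_iff.2 hq
  rw [div_add_div _ _ hcp.ne' hcq.ne', Real.sinh_add, Real.cosh_add]
  apply div_le_div_of_nonneg_left
  · positivity
  · positivity
  · have := mul_nonneg hsp hsq
    linarith

/-- The sharp one-dimensional Sobolev inequality (9.7)/(9.8) of Appendix A in symmetric
form: for `a < b`, `ρ > 0`, and `u ∈ W¹₂([a,b])` with derivative `v`,
`u(x)² ≤ coth(ρ)·(((b−a)/ρ)·∫_a^b v² dt + (ρ/(b−a))·∫_a^b u² dt)` for all `x ∈ [a,b]`. -/
theorem sobolev_interval_symmetric (a b ρ : ℝ) (hab : a < b) (hρ : 0 < ρ)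
    (v : ℝ → ℝ) (hv : Measurable v)
    (hv2 : IntervalIntegrable (fun t => v t ^ 2) volume a b)
    (u : ℝ → ℝ) (hu : ∀ t ∈ Set.Icc a b, u t = u a + ∫ s in a..t, v s) :
    ∀ x ∈ Set.Icc a b,
      u x ^ 2 ≤
        (Real.cosh ρ / Real.sinh ρ) *
          (((b - a) / ρ) * (∫ t in a..b, v t ^ 2) +
            (ρ / (b - a)) * ∫ t in a..b, u t ^ 2) := by
  intro x hx
  have hvi : IntervalIntegrable v volume a b := by
    refine IntervalIntegrable.mono_fun' (g := fun t => 1 + v t ^ 2)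
      (intervalIntegrable_const.add hv2) hv.aestronglyMeasurable ?_
    refine Filter.Eventually.of_forall fun t => ?_
    simp only [Real.norm_eq_abs]
    rw [← sq_abs]
    nlinarith [sq_nonneg (|v t| - 1), abs_nonneg (v t)]
  set U : ℝ → ℝ := fun t => u a + ∫ s in a..t, v s with hUdef
  have hconst : AbsolutelyContinuousOnInterval (fun _ : ℝ => u a) a b :=
    (contDiff_const (n := 1)).contDiffOn.absolutelyContinuousOnInterval
  have hU : AbsolutelyContinuousOnInterval U a b :=
    hconst.fun_add (hvi.absolutelyContinuousOnInterval_intervalIntegral (by simp))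
  have hUv : ∀ᵐ t, t ∈ Set.Icc a b → HasDerivAt U (v t) t := by
    filter_upwards [hvi.ae_hasDerivAt_integral] with t ht htm
    rw [Set.uIcc_of_le hab.le] at ht
    exact (ht htm a (Set.left_mem_Icc.2 hab.le)).const_add _
  obtain ⟨hax, hxb⟩ := hx
  set k := ρ / (b - a) with hk
  have hba : 0 < b - a := sub_pos.2 hab
  have hkpos : 0 < k := div_pos hρ hba
  have s1 : Set.uIcc a x ⊆ Set.uIcc a b := by
    rw [Set.uIcc_of_le hax, Set.uIcc_of_le hab.le]; exact Set.Icc_subset_Icc_right hxb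
  have s2 : Set.uIcc x b ⊆ Set.uIcc a b := by
    rw [Set.uIcc_of_le hxb, Set.uIcc_of_le hab.le]; exact Set.Icc_subset_Icc_left hax
  have P1 := aux_piece k a a x hkpos hax v U (hv2.mono_set s1) (hU.mono s1)
    (by filter_upwards [hUv] with t ht htm using ht ⟨htm.1, htm.2.trans hxb⟩)
  have P2 := aux_piece k b x b hkpos hxb v U (hv2.mono_set s2) (hU.mono s2)
    (by filter_upwards [hUv] with t ht htm using ht ⟨hax.trans htm.1, htm.2⟩)
  have hi1 : IntervalIntegrable (fun t => k⁻¹ * v t ^ 2) volume a b := hv2.const_mul _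
  have hi2 : IntervalIntegrable (fun t => k * U t ^ 2) volume a b :=
    (hU.continuousOn.pow 2).intervalIntegrable.const_mul _
  have hint := hi1.add hi2
  have hsum := intervalIntegral.integral_add_adjacent_intervals
    (hint.mono_set s1) (hint.mono_set s2)
  have hsplit : ∫ t in a..b, (k⁻¹ * v t ^ 2 + k * U t ^ 2)
      = k⁻¹ * (∫ t in a..b, v t ^ 2) + k * ∫ t in a..b, U t ^ 2 := by
    rw [intervalIntegral.integral_add hi1 hi2, intervalIntegral.integral_const_mul,
      intervalIntegral.integral_const_mul]
  have hUu : ∫ t in a..b, U t ^ 2 = ∫ t in a..b, u t ^ 2 := by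
    refine intervalIntegral.integral_congr fun t ht => ?_
    rw [Set.uIcc_of_le hab.le] at ht
    simp only [hUdef]
    rw [hu t ht]
  have hUx : U x = u x := (hu x ⟨hax, hxb⟩).symm
  have hT := aux_tanh (k * (x - a)) (k * (b - x)) (mul_nonneg hkpos.le (sub_nonneg.2 hax))
    (mul_nonneg hkpos.le (sub_nonneg.2 hxb))
  have hadd : k * (x - a) + k * (b - x) = ρ := by
    rw [hk]; field_simp; ring
  rw [hadd] at hT
  have hneg : k * (x - b) = -(k * (b - x)) := by ring
  rw [hneg, Real.sinh_neg, Real.cosh_neg] at P2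
  simp only [sub_self, mul_zero, Real.sinh_zero, zero_div, zero_mul, sub_zero, zero_sub,
    neg_div, neg_mul, neg_neg] at P1 P2
  have hkinv : (b - a) / ρ = k⁻¹ := by rw [hk, inv_div]
  have hE : Real.sinh ρ / Real.cosh ρ * u x ^ 2
      ≤ k⁻¹ * (∫ t in a..b, v t ^ 2) + k * ∫ t in a..b, u t ^ 2 := by
    rw [← hUu, ← hsplit, ← hUx]
    calc _ ≤ _ := mul_le_mul_of_nonneg_right hT (sq_nonneg _)
      _ ≤ _ := by rw [add_mul]; exact (add_le_add P1 P2).trans hsum.le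
  rw [hkinv]
  have hs := Real.sinh_pos_iff.2 hρ
  have hc := Real.cosh_pos ρ
  calc u x ^ 2 = Real.cosh ρ / Real.sinh ρ * (Real.sinh ρ / Real.cosh ρ * u x ^ 2) := by
        field_simp
    _ ≤ _ := mul_le_mul_of_nonneg_left hE (by positivity)
end

section
/- For bounded nonempty open intervals I₁, I₂ ⊆ ℝ and measurable f : ℝ² → [0,∞], define the mixed norm ‖f‖_{L₁(I₁, L_B(I₂))} := ∫_{I₁} ‖f(x₁,·)‖^av_{B,I₂} dx₁, where ‖h‖^av_{B,I} := sup { ∫_I h·g : g : I → [0,∞) measurable with ∫_I (e^g − 1 − g) ≤ |I| } and |I| is the length of I. If the rectangles I_{1,k} × I_{2,k}, k = 1, …, n (with I_{1,k}, I_{2,k} open intervals) are pairwise disjoint subsets of I₁ × I₂, then ∑_{k=1}^n ‖f‖_{L₁(I_{1,k}, L_B(I_{2,k}))} ≤ ‖f‖_{L₁(I₁, L_B(I₂))}, all quantities interpreted in [0,∞]. -/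
open MeasureTheory ENNReal

/-- Solomyak's averaged Orlicz norm `‖h‖^av_{B,I}` of a nonnegative function `h` on a
set `I ⊆ ℝ`: the supremum of `∫_I h·g` over nonnegative measurable `g` with
`∫_I (e^g − 1 − g) ≤ |I|`. -/
noncomputable def avNormB (I : Set ℝ) (h : ℝ → ℝ≥0∞) : ℝ≥0∞ :=
  sSup {r : ℝ≥0∞ | ∃ g : ℝ → NNReal, Measurable g ∧
    (∫⁻ y in I, ENNReal.ofReal (Real.exp (g y) - 1 - (g y : ℝ))) ≤ volume I ∧
    r = ∫⁻ y in I, h y * (g y : ℝ≥0∞)}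

/-- The mixed norm `‖f‖_{L₁(I₁, L_B(I₂))} = ∫_{I₁} ‖f(x₁,·)‖^av_{B,I₂} dx₁`. -/
noncomputable def mixedNormL1B (I₁ I₂ : Set ℝ) (f : ℝ × ℝ → ℝ≥0∞) : ℝ≥0∞ :=
  ∫⁻ x in I₁, avNormB I₂ (fun y => f (x, y))

theorem avNormB_union {S T : Set ℝ} (hS : MeasurableSet S) (hT : MeasurableSet T)
    (hd : Disjoint S T) (h : ℝ → ℝ≥0∞) :
    avNormB S h + avNormB T h ≤ avNormB (S ∪ T) h := by
  classical
  have hne : ∀ U : Set ℝ, {r : ℝ≥0∞ | ∃ g : ℝ → NNReal, Measurable g ∧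
    (∫⁻ y in U, ENNReal.ofReal (Real.exp (g y) - 1 - (g y : ℝ))) ≤ volume U ∧
    r = ∫⁻ y in U, h y * (g y : ℝ≥0∞)}.Nonempty := by
    intro U
    exact ⟨_, fun _ => 0, measurable_const, by simp, rfl⟩
  conv_lhs => unfold avNormB
  rw [sSup_eq_iSup, sSup_eq_iSup]
  refine ENNReal.biSup_add_biSup_le' (p := fun r => r ∈ _) (q := fun r => r ∈ _) (hne S) (hne T) ?_
  rintro _ ⟨g, hg, hgi, rfl⟩ _ ⟨k, hk, hki, rfl⟩
  have e1 : ∀ F : ℝ → NNReal → ℝ≥0∞, ∫⁻ y in S ∪ T, F y (S.piecewise g k y) =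
      (∫⁻ y in S, F y (g y)) + ∫⁻ y in T, F y (k y) := by
    intro F
    rw [lintegral_union hT hd]
    congr 1
    · refine setLIntegral_congr_fun hS fun y hy => ?_
      simp [hy]
    · refine setLIntegral_congr_fun hT fun y hy => ?_
      have : y ∉ S := fun h' => Set.disjoint_left.1 hd h' hy
      simp [this]
  refine le_sSup ⟨S.piecewise g k, hg.piecewise hS hk, ?_, ?_⟩
  · rw [e1 (fun _ t => ENNReal.ofReal (Real.exp t - 1 - (t : ℝ))), measure_union hd hT]
    exact add_le_add hgi hki
  · rw [e1 (fun y t => h y * (t : ℝ≥0∞))]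

theorem avNormB_mono {S T : Set ℝ} (hS : MeasurableSet S) (hT : MeasurableSet T)
    (hST : S ⊆ T) (h : ℝ → ℝ≥0∞) : avNormB S h ≤ avNormB T h := by
  have := avNormB_union hS (hT.diff hS) Set.disjoint_sdiff_right h
  rw [Set.union_diff_cancel hST] at this
  exact le_self_add.trans this

theorem avNormB_sum {ι : Type*} (K : Finset ι) (S : ι → Set ℝ) (hS : ∀ k, MeasurableSet (S k))
    (hd : (K : Set ι).PairwiseDisjoint S) (h : ℝ → ℝ≥0∞) :
    ∑ k ∈ K, avNormB (S k) h ≤ avNormB (⋃ k ∈ K, S k) h := by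
  classical
  induction K using Finset.induction_on with
  | empty => simp
  | insert a K ha ih =>
    rw [Finset.sum_insert ha, Finset.set_biUnion_insert]
    refine le_trans (add_le_add le_rfl (ih (hd.subset (by simp)))) ?_
    refine avNormB_union (hS a) (K.measurableSet_biUnion fun k _ => hS k) ?_ h
    rw [Set.disjoint_iUnion₂_right]
    intro k hk
    exact hd (by simp) (by simp [hk]) (fun e => ha (e ▸ hk))

theorem sum_lintegral_le {ι : Type*} (K : Finset ι) (F : ι → ℝ → ℝ≥0∞) :
    ∑ k ∈ K, ∫⁻ x, F k x ≤ ∫⁻ x, ∑ k ∈ K, F k x := by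
  classical
  induction K using Finset.induction_on with
  | empty => simp
  | insert a K ha ih =>
    simp only [Finset.sum_insert ha]
    exact (add_le_add le_rfl ih).trans (le_lintegral_add _ _)

/-- Lemma `subadd`: if the rectangles `I_{1,k} × I_{2,k}` are pairwise disjoint subsets of
`I₁ × I₂`, then `∑_k ‖f‖_{L₁(I_{1,k}, L_B(I_{2,k}))} ≤ ‖f‖_{L₁(I₁, L_B(I₂))}`. -/
theorem mixedNorm_superadditive (a₁ b₁ a₂ b₂ : ℝ) (h₁ : a₁ < b₁) (h₂ : a₂ < b₂)
    (f : ℝ × ℝ → ℝ≥0∞) (hf : Measurable f)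
    (n : ℕ) (c₁ d₁ c₂ d₂ : Fin n → ℝ)
    (hc₁ : ∀ k, c₁ k < d₁ k) (hc₂ : ∀ k, c₂ k < d₂ k)
    (hsub : ∀ k, (Set.Ioo (c₁ k) (d₁ k)) ×ˢ (Set.Ioo (c₂ k) (d₂ k)) ⊆
      (Set.Ioo a₁ b₁) ×ˢ (Set.Ioo a₂ b₂))
    (hdisj : Pairwise fun k l =>
      Disjoint ((Set.Ioo (c₁ k) (d₁ k)) ×ˢ (Set.Ioo (c₂ k) (d₂ k)))
        ((Set.Ioo (c₁ l) (d₁ l)) ×ˢ (Set.Ioo (c₂ l) (d₂ l)))) :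
    (∑ k : Fin n, mixedNormL1B (Set.Ioo (c₁ k) (d₁ k)) (Set.Ioo (c₂ k) (d₂ k)) f) ≤
      mixedNormL1B (Set.Ioo a₁ b₁) (Set.Ioo a₂ b₂) f := by
  classical
  unfold mixedNormL1B
  simp only [← lintegral_indicator measurableSet_Ioo]
  refine (sum_lintegral_le _ _).trans (lintegral_mono fun x => ?_)
  simp only [Set.indicator_apply]
  rw [← Finset.sum_filter]
  have hS : ∀ k, x ∈ Set.Ioo (c₁ k) (d₁ k) →
      x ∈ Set.Ioo a₁ b₁ ∧ Set.Ioo (c₂ k) (d₂ k) ⊆ Set.Ioo a₂ b₂ := by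
    intro k hk
    obtain ⟨y, hy⟩ := Set.nonempty_Ioo.2 (hc₂ k)
    exact ⟨(hsub k (Set.mk_mem_prod hk hy)).1, fun z hz => (hsub k (Set.mk_mem_prod hk hz)).2⟩
  by_cases hx : x ∈ Set.Ioo a₁ b₁
  · rw [if_pos hx]
    refine (avNormB_sum _ (fun k => Set.Ioo (c₂ k) (d₂ k)) (fun _ => measurableSet_Ioo) ?_ _).trans
      (avNormB_mono (Finset.measurableSet_biUnion _ fun _ _ => measurableSet_Ioo)
        measurableSet_Ioo ?_ _)
    · intro k hk l hl hkl
      have hk' := (Finset.mem_filter.1 (Finset.mem_coe.1 hk)).2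
      have hl' := (Finset.mem_filter.1 (Finset.mem_coe.1 hl)).2
      refine Set.disjoint_left.2 fun y hy hy' => ?_
      exact Set.disjoint_left.1 (hdisj hkl) (Set.mk_mem_prod hk' hy) (Set.mk_mem_prod hl' hy')
    · exact Set.iUnion₂_subset fun k hk => (hS k (Finset.mem_filter.1 hk).2).2
  · rw [Finset.filter_false_of_mem fun k _ hk => hx (hS k hk).1]
    simp
end

section
/- There exists a constant C > 0 with the following property. Let I₁, I₂ ⊆ ℝ be bounded nonempty open intervals of lengths R₁ and R₂, let V : ℝ² → [0,∞) be measurable, and let w : ℝ² → ℝ be continuously differentiable on an open set containing the closure of I₁ × I₂ with ∫_{I₁×I₂} w(x) dx = 0. Then ∫_{I₁×I₂} V(x)·w(x)² dx ≤ C · max{R₁/R₂, R₂/R₁} · ‖V‖_{L₁(I₁, L_B(I₂))} · ∫_{I₁×I₂} ‖(∇w)(x)‖² dx, where ‖V‖_{L₁(I₁, L_B(I₂))} := ∫_{I₁} ‖V(x₁,·)‖^av_{B,I₂} dx₁ and ‖h‖^av_{B,I} := sup { ∫_I h·g : g : I → [0,∞) measurable with ∫_I (e^g − 1 − g) ≤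 |I| }. -/
open MeasureTheory ENNReal

lemma pt_ftc {a b : ℝ} (hab : a ≤ b) (g g' : ℝ → ℝ) (hc : ContinuousOn g (Set.Icc a b))
    (hd : ∀ x ∈ Set.Ioo a b, HasDerivAt g (g' x) x) (hn : ∀ x ∈ Set.Ioo a b, 0 ≤ g' x) :
    ∫⁻ t in Set.Ioo a b, ENNReal.ofReal (g' t) = ENNReal.ofReal (g b - g a) := by
  have hi := intervalIntegral.integrableOn_deriv_of_nonneg hc hd hn
  have h2 : ∫ y in a..b, g' y = g b - g a :=
    intervalIntegral.integral_eq_sub_of_hasDerivAt_of_le hab hc hd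
      ((intervalIntegrable_iff_integrableOn_Ioc_of_le hab).2 hi)
  rw [← h2, intervalIntegral.integral_of_le hab, integral_Ioc_eq_integral_Ioo,
    ofReal_integral_eq_lintegral_ofReal (hi.mono_set Set.Ioo_subset_Ioc_self)]
  exact (ae_restrict_iff' measurableSet_Ioo).2 (Filter.Eventually.of_forall hn)

lemma pt_reflect (φ : ℝ → ℝ≥0∞) (hφ : Measurable φ) (c : ℝ) (hc : c ∈ Set.Ioo (0:ℝ) 1) :
    ∫⁻ y in Set.Ioo (0:ℝ) 1, φ |y - c| ≤ 2 * ∫⁻ s in Set.Ioo (0:ℝ) 1, φ s := by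
  let ψ : ℝ → ℝ≥0∞ := (Set.Ioo (0:ℝ) 1).indicator φ
  have hψ : Measurable ψ := hφ.indicator measurableSet_Ioo
  have e1 : ∫⁻ y, ψ (y - c) = ∫⁻ s in Set.Ioo (0:ℝ) 1, φ s := by
    rw [lintegral_sub_right_eq_self (fun y => ψ y) c, lintegral_indicator measurableSet_Ioo]
  have e2 : ∫⁻ y, ψ (c - y) = ∫⁻ s in Set.Ioo (0:ℝ) 1, φ s := by
    rw [lintegral_sub_left_eq_self (fun y => ψ y) c, lintegral_indicator measurableSet_Ioo]
  calc ∫⁻ y in Set.Ioo (0:ℝ) 1, φ |y - c|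
      ≤ ∫⁻ y, (ψ (y - c) + ψ (c - y)) := by
        rw [← lintegral_indicator measurableSet_Ioo]
        apply lintegral_mono_ae
        have : ∀ᵐ y : ℝ, y ≠ c := by
          simp [ae_iff]
        filter_upwards [this] with y hy
        by_cases hm : y ∈ Set.Ioo (0:ℝ) 1
        · rw [Set.indicator_of_mem hm]
          rcases lt_or_gt_of_ne hy with h | h
          · have : c - y ∈ Set.Ioo (0:ℝ) 1 := ⟨by linarith, by linarith [hm.1, hc.2]⟩
            rw [abs_of_neg (by linarith), neg_sub]
            simp only [ψ, Set.indicator_of_mem this]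
            exact le_add_self
          · have : y - c ∈ Set.Ioo (0:ℝ) 1 := ⟨by linarith, by linarith [hm.2, hc.1]⟩
            rw [abs_of_pos (by linarith)]
            simp only [ψ, Set.indicator_of_mem this]
            exact le_self_add
        · simp [Set.indicator_of_notMem hm]
    _ = 2 * ∫⁻ s in Set.Ioo (0:ℝ) 1, φ s := by
        rw [lintegral_add_left (by fun_prop), e1, e2, two_mul]

lemma pt_sqrt_int (c : ℝ) (hc : c ∈ Set.Ioo (0:ℝ) 1) :
    ∫⁻ y in Set.Ioo (0:ℝ) 1, ENNReal.ofReal (1 / √|y - c|) ≤ 4 := by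
  refine (pt_reflect (fun s => ENNReal.ofReal (1 / √s)) (by fun_prop) c hc).trans ?_
  rw [pt_ftc zero_le_one (fun s => 2 * √s) (fun s => 1 / √s) (by fun_prop)]
  · norm_num
  · intro x hx
    have := (Real.hasDerivAt_sqrt hx.1.ne').const_mul 2
    refine this.congr_deriv ?_
    have hs : 0 < √x := Real.sqrt_pos.2 hx.1
    field_simp
  · intro x hx
    positivity

noncomputable def ptk (τ r : ℝ) : ℝ := 1 / (r ^ 2 * (1 + τ / √r))

lemma pt_k_int (τ : ℝ) (hτ : 0 < τ) :
    ∫⁻ r in Set.Ioo (0:ℝ) 1, ENNReal.ofReal (ptk τ r * r) = ENNReal.ofReal (2 * Real.log (1 + 1 / τ)) := by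
  have : 2 * Real.log (1 + 1 / τ) = 2 * Real.log (√1 + τ) - 2 * Real.log (√0 + τ) := by
    rw [Real.sqrt_one, Real.sqrt_zero, zero_add, ← mul_sub, ← Real.log_div (by positivity) (by positivity)]
    congr 2
    field_simp
    ring
  rw [this]
  apply pt_ftc zero_le_one (fun s => 2 * Real.log (√s + τ)) (fun r => ptk τ r * r)
  · apply ContinuousOn.mul (by fun_prop)
    apply ContinuousOn.log (by fun_prop)
    intro x hx
    positivity
  · intro x hx
    have hx0 := hx.1
    have h1 := (((Real.hasDerivAt_sqrt hx.1.ne').add_const τ).log (by positivity)).const_mul 2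
    refine h1.congr_deriv ?_
    unfold ptk
    have hs : 0 < √x := Real.sqrt_pos.2 hx0
    obtain ⟨s, hs', rfl⟩ : ∃ s, 0 < s ∧ x = s^2 := ⟨√x, hs, (Real.sq_sqrt hx0.le).symm⟩
    rw [Real.sqrt_sq hs'.le]
    field_simp
  · intro x hx
    have := hx.1
    unfold ptk
    positivity

lemma ptk_meas (τ : ℝ) : Measurable (ptk τ) := by unfold ptk; fun_prop

abbrev ptQ : Set (ℝ × ℝ) := Set.Ioo (0:ℝ) 1 ×ˢ Set.Ioo (0:ℝ) 1

lemma ptQ_restrict : (volume : Measure (ℝ × ℝ)).restrict ptQ =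
    (volume.restrict (Set.Ioo (0:ℝ) 1)).prod (volume.restrict (Set.Ioo (0:ℝ) 1)) := by
  rw [Measure.prod_restrict]; rfl

lemma pt_norm (u p : ℝ × ℝ) : ‖u - p‖ = max |u.1 - p.1| |u.2 - p.2| := rfl

lemma pt_K (τ : ℝ) (hτ : 0 < τ) (p : ℝ × ℝ) (hp : p ∈ ptQ) :
    ∫⁻ u in ptQ, ENNReal.ofReal (ptk τ ‖u - p‖) ≤ ENNReal.ofReal (16 * Real.log (1 + 1 / τ)) := by
  have hm := ptk_meas τ
  have hm1 : Measurable fun q : ℝ × ℝ => ENNReal.ofReal (ptk τ (max q.1 q.2)) := by fun_prop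
  set μ := volume.restrict (Set.Ioo (0:ℝ) 1) with hμ
  have h1 : ∀ a : ℝ, ∫⁻ y, ENNReal.ofReal (ptk τ (max a |y - p.2|)) ∂μ ≤
      2 * ∫⁻ s, ENNReal.ofReal (ptk τ (max a s)) ∂μ := fun a =>
    pt_reflect (fun s => ENNReal.ofReal (ptk τ (max a s))) (by fun_prop) p.2 hp.2
  have h2 : ∫⁻ x, (∫⁻ s, ENNReal.ofReal (ptk τ (max |x - p.1| s)) ∂μ) ∂μ ≤
      2 * ∫⁻ r, ∫⁻ s, ENNReal.ofReal (ptk τ (max r s)) ∂μ ∂μ := 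
    pt_reflect (fun r => ∫⁻ s, ENNReal.ofReal (ptk τ (max r s)) ∂μ) hm1.lintegral_prod_right' p.1 hp.1
  let f : ℝ → ℝ → ℝ≥0∞ := fun r s => (Set.Iic r).indicator (fun _ => ENNReal.ofReal (ptk τ r)) s
  have hfm : Measurable (fun q : ℝ × ℝ => f q.1 q.2) := by
    have : (fun q : ℝ × ℝ => f q.1 q.2) = {q : ℝ × ℝ | q.2 ≤ q.1}.indicator (fun q => ENNReal.ofReal (ptk τ q.1)) := by
      ext q; simp [f, Set.indicator]
    rw [this]
    exact Measurable.indicator (by fun_prop) (measurableSet_le measurable_snd measurable_fst)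
  have hfi : ∫⁻ r, ∫⁻ s, f r s ∂μ ∂μ ≤ ENNReal.ofReal (2 * Real.log (1 + 1 / τ)) := by
    rw [← pt_k_int τ hτ]
    apply setLIntegral_mono (by fun_prop)
    intro r hr
    simp only [f]
    rw [lintegral_indicator measurableSet_Iic, lintegral_const, Measure.restrict_apply .univ, Set.univ_inter,
      hμ, Measure.restrict_apply measurableSet_Iic, ENNReal.ofReal_mul (by unfold ptk; have := hr.1; positivity)]
    gcongr
    calc volume (Set.Iic r ∩ Set.Ioo 0 1) ≤ volume (Set.Ioc 0 r) := measure_mono (fun s hs => ⟨hs.2.1, hs.1⟩)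
      _ = _ := by simp
  have h3 : ∫⁻ r, ∫⁻ s, ENNReal.ofReal (ptk τ (max r s)) ∂μ ∂μ ≤ 2 * ENNReal.ofReal (2 * Real.log (1 + 1 / τ)) := by
    calc _ ≤ ∫⁻ r, ∫⁻ s, (f r s + f s r) ∂μ ∂μ := by
          apply lintegral_mono; intro r
          apply lintegral_mono; intro s
          rcases le_total s r with h | h
          · simp only [f, max_eq_left h, Set.indicator_of_mem (show s ∈ Set.Iic r from h)]
            exact le_self_add
          · simp only [f, max_eq_right h, Set.indicator_of_mem (show r ∈ Set.Iic s from h)]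
            exact le_add_self
      _ = ∫⁻ r, ∫⁻ s, f r s ∂μ ∂μ + ∫⁻ r, ∫⁻ s, f s r ∂μ ∂μ := by
          rw [← lintegral_add_left hfm.lintegral_prod_right']
          congr 1; ext r
          exact lintegral_add_left (hfm.comp (by fun_prop : Measurable fun s => (r, s))) _
      _ ≤ _ := by
          rw [two_mul]
          refine add_le_add hfi ?_
          have := lintegral_lintegral_swap (μ := μ) (ν := μ) (f := f) hfm.aemeasurable
          exact this ▸ hfi
  calc ∫⁻ u in ptQ, ENNReal.ofReal (ptk τ ‖u - p‖)
      = ∫⁻ x, ∫⁻ y, ENNReal.ofReal (ptk τ (max |x - p.1| |y - p.2|)) ∂μ ∂μ := by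
        rw [ptQ_restrict, lintegral_prod _ (by fun_prop)]
        rfl
    _ ≤ ∫⁻ x, 2 * ∫⁻ s, ENNReal.ofReal (ptk τ (max |x - p.1| s)) ∂μ ∂μ := lintegral_mono fun x => h1 _
    _ = 2 * ∫⁻ x, ∫⁻ s, ENNReal.ofReal (ptk τ (max |x - p.1| s)) ∂μ ∂μ := lintegral_const_mul' _ _ (by simp)
    _ ≤ 2 * (2 * (2 * ENNReal.ofReal (2 * Real.log (1 + 1 / τ)))) := by
        gcongr; exact h2.trans (by gcongr)
    _ = _ := by
        rw [show (16 : ℝ) * Real.log (1 + 1 / τ) = 8 * (2 * Real.log (1 + 1 / τ)) by ring, 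
          ENNReal.ofReal_mul (by norm_num), ENNReal.ofReal_ofNat]
        rw [← mul_assoc, ← mul_assoc]; norm_num

lemma ptQ_convex : Convex ℝ ptQ := (convex_Ioo 0 1).prod (convex_Ioo 0 1)

lemma ptQ_vol : volume ptQ = 1 := by
  rw [Measure.volume_eq_prod, Measure.prod_prod]; simp

lemma ptQ_meas : MeasurableSet ptQ := measurableSet_Ioo.prod measurableSet_Ioo

lemma pt_path (W : ℝ × ℝ → ℝ) (U : Set (ℝ × ℝ)) (hU : IsOpen U) (hQ : ptQ ⊆ U)
    (hW : ContDiffOn ℝ 1 W U) (p z : ℝ × ℝ) (hp : p ∈ ptQ) (hz : z ∈ ptQ) :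
    ‖W p - W z‖ₑ ≤ ∫⁻ t in Set.Ioo (0:ℝ) 1, ‖fderiv ℝ W (p + t • (z - p))‖ₑ * ‖z - p‖ₑ := by
  have hmem : ∀ t ∈ Set.Icc (0:ℝ) 1, p + t • (z - p) ∈ U := fun t ht =>
    hQ (ptQ_convex.add_smul_sub_mem hp hz ht)
  have hd : ∀ t ∈ Set.uIcc (0:ℝ) 1, HasDerivAt (fun t : ℝ => W (p + t • (z - p)))
      (fderiv ℝ W (p + t • (z - p)) (z - p)) t := by
    intro t ht
    rw [Set.uIcc_of_le zero_le_one] at ht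
    have h1 : HasFDerivAt W (fderiv ℝ W (p + t • (z - p))) (p + t • (z - p)) :=
      ((hW.contDiffAt (hU.mem_nhds (hmem t ht))).differentiableAt (by norm_num)).hasFDerivAt
    have h2 : HasDerivAt (fun t : ℝ => p + t • (z - p)) (z - p) t := by
      simpa using ((hasDerivAt_id t).smul_const (z - p)).const_add p
    exact h1.comp_hasDerivAt t h2
  have hc : ContinuousOn (fun t : ℝ => fderiv ℝ W (p + t • (z - p)) (z - p)) (Set.uIcc (0:ℝ) 1) := by
    rw [Set.uIcc_of_le zero_le_one]
    have h3 : ContinuousOn (fderiv ℝ W) U := hW.continuousOn_fderiv_of_isOpen hU (by norm_num)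
    have h4 : ContinuousOn (fun t : ℝ => fderiv ℝ W (p + t • (z - p))) (Set.Icc (0:ℝ) 1) :=
      h3.comp (by fun_prop) hmem
    exact h4.clm_apply continuousOn_const
  have h5 := intervalIntegral.integral_eq_sub_of_hasDerivAt hd hc.intervalIntegrable
  simp only [one_smul, zero_smul, add_zero, add_sub_cancel] at h5
  rw [enorm_sub_rev, ← h5, intervalIntegral.integral_of_le zero_le_one, integral_Ioc_eq_integral_Ioo]
  refine (enorm_integral_le_lintegral_enorm _).trans (lintegral_mono fun t => ?_)
  exact ContinuousLinearMap.le_opENorm _ _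

lemma pt_rep1 (W : ℝ × ℝ → ℝ) (U : Set (ℝ × ℝ)) (hU : IsOpen U) (hQ : closure ptQ ⊆ U)
    (hW : ContDiffOn ℝ 1 W U) (h0 : ∫ x in ptQ, W x = 0) (p : ℝ × ℝ) (hp : p ∈ ptQ) :
    ‖W p‖ₑ ≤ ∫⁻ z in ptQ, ∫⁻ t in Set.Ioo (0:ℝ) 1,
      ‖fderiv ℝ W (p + t • (z - p))‖ₑ * ‖z - p‖ₑ := by
  have hK : IsCompact (closure ptQ) := by
    rw [closure_prod_eq, closure_Ioo (by norm_num)]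
    exact isCompact_Icc.prod isCompact_Icc
  have hi : IntegrableOn W ptQ :=
    ((hW.continuousOn.mono hQ).integrableOn_compact hK).mono_set subset_closure
  have h1 : W p = ∫ z in ptQ, (W p - W z) := by
    have hc : IntegrableOn (fun _ : ℝ × ℝ => W p) ptQ volume :=
      integrableOn_const (by rw [ptQ_vol]; simp) (by simp)
    rw [integral_sub hc hi, h0]
    simp [Measure.real, ptQ_vol]
  rw [h1]
  refine (enorm_integral_le_lintegral_enorm _).trans ?_
  refine setLIntegral_mono' ptQ_meas fun z hz => ?_
  exact pt_path W U hU (subset_closure.trans hQ) hW p z hp hz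

lemma pt_homothety (F : ℝ × ℝ → ℝ≥0∞) (p : ℝ × ℝ) (t : ℝ) (ht : 0 < t) :
    ∫⁻ z, F (p + t • (z - p)) = ENNReal.ofReal (1 / t ^ 2) * ∫⁻ u, F u := by
  have e1 : ∫⁻ z, F (p + t • (z - p)) = ∫⁻ z, F (p + t • z) :=
    lintegral_sub_right_eq_self (fun z => F (p + t • z)) p
  have e2 : ∫⁻ z, F (p + t • z) = ∫⁻ u, F (p + u) ∂(Measure.map (t • ·) volume) := by
    have := (MeasurableEquiv.smul₀ t ht.ne').measurableEmbedding.lintegral_map (μ := (volume : Measure (ℝ × ℝ))) (fun u => F (p + u))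
    exact this.symm
  rw [e1, e2, Measure.map_addHaar_smul volume ht.ne', lintegral_smul_measure, lintegral_add_left_eq_self F p]
  simp [abs_of_pos ht]

lemma pt_t3 (r : ℝ) (hr : 0 < r) (hr1 : r ≤ 1) :
    ∫⁻ t in Set.Ioo r 1, ENNReal.ofReal (1 / t ^ 3) ≤ ENNReal.ofReal (1 / r ^ 2) := by
  rw [pt_ftc hr1 (fun t => - (1 / (2 * t ^ 2))) (fun t => 1 / t ^ 3)]
  · apply ENNReal.ofReal_le_ofReal
    have : 1 / r ^ 2 = 1 / (2 * r ^ 2) + 1 / (2 * r ^ 2) := by field_simp; norm_num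
    rw [this]
    have : 0 < 1 / (2 * r ^ 2) := by positivity
    have h2 : (1:ℝ) / (2 * 1 ^ 2) = 1 / 2 := by norm_num
    show - ((1:ℝ) / (2 * 1 ^ 2)) - - (1 / (2 * r ^ 2)) ≤ _
    rw [h2]
    linarith
  · apply ContinuousOn.neg
    apply ContinuousOn.div (by fun_prop) (by fun_prop)
    intro x hx
    have := hr.trans_le hx.1
    positivity
  · intro x hx
    have hx0 := hr.trans hx.1
    have := (((hasDerivAt_pow 2 x).const_mul 2).fun_inv (by positivity)).fun_neg
    simp only [one_div]
    refine this.congr_deriv ?_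
    field_simp
    norm_num
  · intro x hx
    have := hr.trans hx.1
    positivity

lemma pt_rep (h : ℝ × ℝ → ℝ≥0∞) (hm : Measurable h) (p : ℝ × ℝ) (hp : p ∈ ptQ) :
    ∫⁻ z in ptQ, ∫⁻ t in Set.Ioo (0:ℝ) 1, h (p + t • (z - p)) * ‖z - p‖ₑ ≤
      ∫⁻ u in ptQ, h u * ENNReal.ofReal (1 / ‖u - p‖) := by
  rw [lintegral_lintegral_swap (by fun_prop)]
  let F : ℝ → ℝ × ℝ → ℝ≥0∞ := fun t u =>
    (Set.Ioi ‖u - p‖).indicator (fun t => h u * ENNReal.ofReal (‖u - p‖ / t)) t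
  have hF : Measurable (fun q : ℝ × (ℝ × ℝ) => F q.1 q.2) := by
    have : (fun q : ℝ × (ℝ × ℝ) => F q.1 q.2) = {q : ℝ × (ℝ × ℝ) | ‖q.2 - p‖ < q.1}.indicator
        (fun q => h q.2 * ENNReal.ofReal (‖q.2 - p‖ / q.1)) := by
      ext q; simp [F, Set.indicator]
    rw [this]
    exact Measurable.indicator (by fun_prop) (measurableSet_lt (by fun_prop) (by fun_prop))
  have h1 : ∀ t ∈ Set.Ioo (0:ℝ) 1, ∫⁻ z in ptQ, h (p + t • (z - p)) * ‖z - p‖ₑ ≤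
      ∫⁻ u in ptQ, ENNReal.ofReal (1 / t ^ 2) * F t u := by
    intro t ht
    have := pt_homothety (ptQ.indicator (F t)) p t ht.1
    rw [lintegral_const_mul' _ _ (by simp), ← lintegral_indicator ptQ_meas (F t), ← this, 
      ← lintegral_indicator ptQ_meas]
    apply lintegral_mono
    intro z
    by_cases hz : z ∈ ptQ
    · have hu : p + t • (z - p) ∈ ptQ := ptQ_convex.add_smul_sub_mem hp hz ⟨ht.1.le, ht.2.le⟩
      have hn : ‖p + t • (z - p) - p‖ = t * ‖z - p‖ := by
        rw [add_sub_cancel_left, norm_smul, Real.norm_of_nonneg ht.1.le]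
      have hlt : ‖z - p‖ < 1 := by
        rw [pt_norm, max_lt_iff, abs_lt, abs_lt]
        refine ⟨⟨?_, ?_⟩, ?_, ?_⟩ <;> linarith [hz.1.1, hz.1.2, hz.2.1, hz.2.2, hp.1.1, hp.1.2, hp.2.1, hp.2.2]
      rw [Set.indicator_of_mem hz]
      beta_reduce
      rw [Set.indicator_of_mem hu]
      simp only [F]
      rw [Set.indicator_of_mem, hn, mul_div_cancel_left₀ _ ht.1.ne', ofReal_norm]
      rw [hn, Set.mem_Ioi]
      nlinarith [ht.1]
    · rw [Set.indicator_of_notMem hz]; exact bot_le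
  calc _ ≤ ∫⁻ t in Set.Ioo (0:ℝ) 1, ∫⁻ u in ptQ, ENNReal.ofReal (1 / t ^ 2) * F t u := 
        setLIntegral_mono' measurableSet_Ioo h1
    _ = ∫⁻ u in ptQ, ∫⁻ t in Set.Ioo (0:ℝ) 1, ENNReal.ofReal (1 / t ^ 2) * F t u := by
        rw [lintegral_lintegral_swap]
        exact (Measurable.mul (by fun_prop) hF).aemeasurable
    _ ≤ _ := by
        refine setLIntegral_mono' ptQ_meas fun u hu => ?_
        have hlt : ‖u - p‖ < 1 := by
          rw [pt_norm, max_lt_iff, abs_lt, abs_lt]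
          refine ⟨⟨?_, ?_⟩, ?_, ?_⟩ <;> linarith [hu.1.1, hu.1.2, hu.2.1, hu.2.2, hp.1.1, hp.1.2, hp.2.1, hp.2.2]
        rcases (norm_nonneg (u - p)).eq_or_lt with h0 | h0
        · simp [F, ← h0]
        set r := ‖u - p‖ with hr
        calc ∫⁻ t in Set.Ioo (0:ℝ) 1, ENNReal.ofReal (1 / t ^ 2) * F t u
            ≤ ∫⁻ t, (Set.Ioo r 1).indicator (fun t => (h u * ENNReal.ofReal r) * ENNReal.ofReal (1 / t ^ 3)) t := by
              rw [← lintegral_indicator measurableSet_Ioo]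
              apply lintegral_mono
              intro t
              by_cases ht : t ∈ Set.Ioo (0:ℝ) 1
              · rw [Set.indicator_of_mem ht]
                by_cases htr : r < t
                · rw [Set.indicator_of_mem (show t ∈ Set.Ioo r 1 from ⟨htr, ht.2⟩)]
                  simp only [F]
                  rw [Set.indicator_of_mem (by exact htr), ← hr, mul_left_comm, mul_assoc,
                    ← ENNReal.ofReal_mul (by positivity), ← ENNReal.ofReal_mul h0.le]
                  apply le_of_eq
                  congr 2
                  have := ht.1
                  field_simp
                · simp only [F]
                  rw [Set.indicator_of_notMem (by exact htr), mul_zero]; exact bot_le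
              · rw [Set.indicator_of_notMem ht]; exact bot_le
          _ = (h u * ENNReal.ofReal r) * ∫⁻ t in Set.Ioo r 1, ENNReal.ofReal (1 / t ^ 3) := by
              rw [lintegral_indicator measurableSet_Ioo, lintegral_const_mul _ (by fun_prop)]
          _ ≤ (h u * ENNReal.ofReal r) * ENNReal.ofReal (1 / r ^ 2) := by
              gcongr; exact pt_t3 r h0 hlt.le
          _ = _ := by
              rw [mul_assoc, ← ENNReal.ofReal_mul h0.le]
              congr 2
              field_simp

lemma pt_cs (h : ℝ × ℝ → ℝ≥0∞) (hm : Measurable h) (p : ℝ × ℝ) (hp : p ∈ ptQ) (τ : ℝ) (hτ : 0 < τ) :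
    (∫⁻ u in ptQ, h u * ENNReal.ofReal (1 / ‖u - p‖)) ^ 2 ≤
      ((∫⁻ u in ptQ, h u ^ 2) + ENNReal.ofReal τ * ∫⁻ u in ptQ, h u ^ 2 * ENNReal.ofReal (1 / √‖u - p‖)) *
        ENNReal.ofReal (16 * Real.log (1 + 1 / τ)) := by
  have hkm := ptk_meas τ
  let f : ℝ × ℝ → ℝ≥0∞ := fun u => h u * ENNReal.ofReal √(1 + τ / √‖u - p‖)
  let g : ℝ × ℝ → ℝ≥0∞ := fun u => ENNReal.ofReal √(ptk τ ‖u - p‖)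
  have hf : Measurable f := by fun_prop
  have hg : Measurable g := by fun_prop
  have hk0 : ∀ u : ℝ × ℝ, 0 ≤ ptk τ ‖u - p‖ := fun u => by unfold ptk; positivity
  have h1 : ∫⁻ u in ptQ, h u * ENNReal.ofReal (1 / ‖u - p‖) ≤ ∫⁻ u in ptQ, (f * g) u := by
    apply lintegral_mono
    intro u
    simp only [f, g, Pi.mul_apply]
    rw [mul_assoc, ← ENNReal.ofReal_mul (by positivity), ← Real.sqrt_mul (by positivity)]
    gcongr
    rcases (norm_nonneg (u - p)).eq_or_lt with h0 | h0
    · rw [← h0]; simp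
    apply Real.le_sqrt_of_sq_le
    unfold ptk
    apply le_of_eq
    have : 0 < 1 + τ / √‖u - p‖ := by positivity
    field_simp
  have h2 := ENNReal.lintegral_mul_le_Lp_mul_Lq (volume.restrict ptQ) Real.HolderConjugate.two_two hf.aemeasurable hg.aemeasurable
  have hsq : ∀ x : ℝ≥0∞, (x ^ (1 / 2 : ℝ)) ^ 2 = x := fun x => by
    rw [← ENNReal.rpow_natCast, ← ENNReal.rpow_mul]; norm_num
  have h3 := pow_le_pow_left₀ (by simp) (h1.trans h2) 2
  rw [mul_pow, hsq, hsq] at h3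
  refine h3.trans ?_
  simp only [ENNReal.rpow_two]
  gcongr
  · rw [← lintegral_const_mul _ (by fun_prop), ← lintegral_add_left (by fun_prop)]
    apply lintegral_mono
    intro u
    simp only [f]
    rw [mul_pow, ← ENNReal.ofReal_pow (by positivity), Real.sq_sqrt (by positivity), 
      ENNReal.ofReal_add (by norm_num) (by positivity), mul_add, mul_left_comm, ← ENNReal.ofReal_mul hτ.le]
    simp [div_eq_mul_inv]
  · refine le_trans (le_of_eq ?_) (pt_K τ hτ p hp)
    congr 1; ext u
    simp only [g]
    rw [← ENNReal.ofReal_pow (by positivity), Real.sq_sqrt (hk0 u)]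

lemma pt_point (h : ℝ × ℝ → ℝ≥0∞) (hm : Measurable h) (p : ℝ × ℝ) (hp : p ∈ ptQ) (H : ℝ) (hH : 0 < H)
    (hH' : ∫⁻ u in ptQ, h u ^ 2 = ENNReal.ofReal H) (s : ℝ) 
    (hs : ‖s‖ₑ ≤ ∫⁻ u in ptQ, h u * ENNReal.ofReal (1 / ‖u - p‖)) :
    ENNReal.ofReal (Real.exp (s ^ 2 / (256 * H)) - 1 - s ^ 2 / (256 * H)) ≤
      ENNReal.ofReal (1 / 8) + ENNReal.ofReal (1 / (8 * H)) * ∫⁻ u in ptQ, h u ^ 2 * ENNReal.ofReal (1 / √‖u - p‖) := by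
  by_cases hM : ∫⁻ u in ptQ, h u ^ 2 * ENNReal.ofReal (1 / √‖u - p‖) = ∞
  · rw [hM, ENNReal.mul_top (by simp; positivity)]; simp
  obtain ⟨M, hM0, hM'⟩ : ∃ M : ℝ, 0 ≤ M ∧ ∫⁻ u in ptQ, h u ^ 2 * ENNReal.ofReal (1 / √‖u - p‖) = ENNReal.ofReal M :=
    ⟨_, ENNReal.toReal_nonneg, (ENNReal.ofReal_toReal hM).symm⟩
  have hτ : 0 < H / (M + H) := by positivity
  have h1 := (pow_le_pow_left₀ (by simp) hs 2).trans (pt_cs h hm p hp _ hτ)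
  have hlog : 0 ≤ Real.log (1 + 1 / (H / (M + H))) := Real.log_nonneg (by
    have : 0 ≤ 1 / (H / (M + H)) := by positivity
    linarith)
  rw [hH', hM', ← ENNReal.ofReal_mul hτ.le, ← ENNReal.ofReal_add hH.le (by positivity), ← ENNReal.ofReal_mul (by positivity),
    ← ofReal_norm, ← ENNReal.ofReal_pow (norm_nonneg _), ENNReal.ofReal_le_ofReal_iff (by positivity), Real.norm_eq_abs, sq_abs] at h1
  rw [hM', ← ENNReal.ofReal_mul (by positivity), ← ENNReal.ofReal_add (by positivity) (by positivity)]
  apply ENNReal.ofReal_le_ofReal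
  have h2 : H + H / (M + H) * M ≤ 2 * H := by
    have : H / (M + H) * M ≤ H := by
      rw [div_mul_eq_mul_div, div_le_iff₀ (by positivity)]; nlinarith
    linarith
  have e : 1 + 1 / (H / (M + H)) = 2 + M / H := by field_simp; ring
  rw [e] at h1 hlog
  have h3 : s ^ 2 ≤ 32 * H * Real.log (2 + M / H) := by
    refine h1.trans ?_
    nlinarith [mul_le_mul_of_nonneg_right h2 hlog]
  set x := s ^ 2 / (256 * H) with hx
  have hx0 : 0 ≤ x := by positivity
  have h4 : 8 * x ≤ Real.log (2 + M / H) := by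
    rw [hx, mul_div_assoc', div_le_iff₀ (by positivity)]; nlinarith
  have h5 : Real.exp (8 * x) ≤ 2 + M / H := by
    rw [← Real.le_log_iff_exp_le (by positivity)]; exact h4
  have h6 : 1 + 8 * (Real.exp x - 1) ≤ Real.exp (8 * x) := by
    have := one_add_mul_le_pow (a := Real.exp x - 1) (by linarith [Real.exp_pos x]) 8
    rw [add_sub_cancel, ← Real.exp_nat_mul] at this
    exact_mod_cast this
  have h7 : 1 / (8 * H) * M = (M / H) / 8 := by field_simp
  rw [h7]
  linarith

lemma pt_unit (W : ℝ × ℝ → ℝ) (U : Set (ℝ × ℝ)) (hU : IsOpen U) (hQ : closure ptQ ⊆ U)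
    (hW : ContDiffOn ℝ 1 W U) (h0 : ∫ x in ptQ, W x = 0) (H : ℝ) (hH : 0 < H)
    (hH' : ∫⁻ u in ptQ, ‖fderiv ℝ W u‖ₑ ^ 2 = ENNReal.ofReal H) (x : ℝ) (hx : x ∈ Set.Ioo (0:ℝ) 1) :
    ∫⁻ y in Set.Ioo (0:ℝ) 1, ENNReal.ofReal (Real.exp (W (x, y) ^ 2 / (256 * H)) - 1 - W (x, y) ^ 2 / (256 * H)) ≤ 1 := by
  set h : ℝ × ℝ → ℝ≥0∞ := fun u => ‖fderiv ℝ W u‖ₑ with hh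
  have hm : Measurable h := (measurable_fderiv ℝ W).enorm
  calc _ ≤ ∫⁻ y in Set.Ioo (0:ℝ) 1, (ENNReal.ofReal (1 / 8) + ENNReal.ofReal (1 / (8 * H)) *
        ∫⁻ u in ptQ, h u ^ 2 * ENNReal.ofReal (1 / √‖u - (x, y)‖)) := by
        refine setLIntegral_mono' measurableSet_Ioo fun y hy => ?_
        have hp : (x, y) ∈ ptQ := ⟨hx, hy⟩
        exact pt_point h hm (x, y) hp H hH hH' _
          ((pt_rep1 W U hU hQ hW h0 (x, y) hp).trans (pt_rep h hm (x, y) hp))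
    _ = ENNReal.ofReal (1 / 8) + ENNReal.ofReal (1 / (8 * H)) * ∫⁻ y in Set.Ioo (0:ℝ) 1, 
        ∫⁻ u in ptQ, h u ^ 2 * ENNReal.ofReal (1 / √‖u - (x, y)‖) := by
        rw [lintegral_add_left (by fun_prop), lintegral_const_mul' _ _ (by simp)]
        simp
    _ = ENNReal.ofReal (1 / 8) + ENNReal.ofReal (1 / (8 * H)) * ∫⁻ u in ptQ, ∫⁻ y in Set.Ioo (0:ℝ) 1, 
        h u ^ 2 * ENNReal.ofReal (1 / √‖u - (x, y)‖) := by
        rw [lintegral_lintegral_swap (by fun_prop)]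
    _ ≤ ENNReal.ofReal (1 / 8) + ENNReal.ofReal (1 / (8 * H)) * ∫⁻ u in ptQ, h u ^ 2 * 4 := by
        gcongr ENNReal.ofReal (1 / 8) + ENNReal.ofReal (1 / (8 * H)) * ?_
        refine setLIntegral_mono' ptQ_meas fun u hu => ?_
        rw [lintegral_const_mul _ (by fun_prop)]
        gcongr
        refine le_trans ?_ (pt_sqrt_int u.2 hu.2)
        apply lintegral_mono_ae
        have : ∀ᵐ y ∂(volume.restrict (Set.Ioo (0:ℝ) 1)), y ≠ u.2 := by
          apply ae_restrict_of_ae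
          simp [ae_iff]
        filter_upwards [this] with y hy
        apply ENNReal.ofReal_le_ofReal
        have : 0 < |y - u.2| := abs_pos.2 (sub_ne_zero.2 hy)
        apply one_div_le_one_div_of_le (by positivity)
        apply Real.sqrt_le_sqrt
        rw [pt_norm, abs_sub_comm y]
        exact le_max_right _ _
    _ ≤ 1 := by
        rw [lintegral_mul_const _ (by fun_prop), hH', ← ENNReal.ofReal_ofNat 4, ← ENNReal.ofReal_mul hH.le, 
          ← ENNReal.ofReal_mul (by positivity), ← ENNReal.ofReal_add (by norm_num) (by positivity), 
          ENNReal.ofReal_le_one]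
        field_simp
        norm_num

lemma pt_unit_zero (W : ℝ × ℝ → ℝ) (U : Set (ℝ × ℝ)) (hU : IsOpen U) (hQ : closure ptQ ⊆ U)
    (hW : ContDiffOn ℝ 1 W U) (h0 : ∫ x in ptQ, W x = 0)
    (hH' : ∫⁻ u in ptQ, ‖fderiv ℝ W u‖ₑ ^ 2 = 0) (p : ℝ × ℝ) (hp : p ∈ ptQ) : W p = 0 := by
  have hm : Measurable (fun u => ‖fderiv ℝ W u‖ₑ) := (measurable_fderiv ℝ W).enorm
  have h1 := (pt_rep1 W U hU hQ hW h0 p hp).trans (pt_rep _ hm p hp)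
  have h2 : ∫⁻ u in ptQ, ‖fderiv ℝ W u‖ₑ * ENNReal.ofReal (1 / ‖u - p‖) = 0 := by
    rw [lintegral_eq_zero_iff (by fun_prop)] at hH'
    rw [lintegral_eq_zero_iff (by fun_prop)]
    filter_upwards [hH'] with u hu
    have : ‖fderiv ℝ W u‖ₑ = 0 := by simpa using hu
    simp [this]
  rw [h2] at h1
  simpa using h1

lemma pt_map1 (a b : ℝ) (hab : a < b) :
    Measure.map (fun s => a + (b - a) * s) (volume.restrict (Set.Ioo (0:ℝ) 1)) =
      ENNReal.ofReal (b - a)⁻¹ • volume.restrict (Set.Ioo a b) := by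
  have hR : 0 < b - a := sub_pos.2 hab
  have e1 : Measure.map (fun s => a + (b - a) * s) volume = ENNReal.ofReal (b - a)⁻¹ • volume := by
    have : (fun s => a + (b - a) * s) = (fun s => a + s) ∘ (fun s => (b - a) * s) := rfl
    rw [this, ← Measure.map_map (by fun_prop) (by fun_prop), Real.map_volume_mul_left hR.ne',
      Measure.map_smul, map_add_left_eq_self, abs_of_pos (by positivity)]
  rw [← Measure.restrict_smul, ← e1, Measure.restrict_map (by fun_prop) measurableSet_Ioo]
  congr 2
  ext s
  simp only [Set.mem_Ioo, Set.mem_preimage]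
  constructor
  · rintro ⟨h1, h2⟩; constructor <;> nlinarith
  · rintro ⟨h1, h2⟩; constructor <;> nlinarith

def ptL (a₁ b₁ a₂ b₂ : ℝ) : ℝ × ℝ → ℝ × ℝ :=
  Prod.map (fun s => a₁ + (b₁ - a₁) * s) (fun s => a₂ + (b₂ - a₂) * s)

lemma pt_emb1 (a b : ℝ) (hab : a < b) : MeasurableEmbedding (fun s : ℝ => a + (b - a) * s) :=
  ((Homeomorph.mulLeft₀ (b - a) (sub_pos.2 hab).ne').trans (Homeomorph.addLeft a)).measurableEmbedding

lemma pt_emb (a₁ b₁ a₂ b₂ : ℝ) (h₁ : a₁ < b₁) (h₂ : a₂ < b₂) : MeasurableEmbedding (ptL a₁ b₁ a₂ b₂) :=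
  (((Homeomorph.mulLeft₀ (b₁ - a₁) (sub_pos.2 h₁).ne').trans (Homeomorph.addLeft a₁)).prodCongr
    ((Homeomorph.mulLeft₀ (b₂ - a₂) (sub_pos.2 h₂).ne').trans (Homeomorph.addLeft a₂))).measurableEmbedding

lemma pt_map2 (a₁ b₁ a₂ b₂ : ℝ) (h₁ : a₁ < b₁) (h₂ : a₂ < b₂) :
    Measure.map (ptL a₁ b₁ a₂ b₂) (volume.restrict ptQ) =
      ENNReal.ofReal ((b₁ - a₁) * (b₂ - a₂))⁻¹ • volume.restrict (Set.Ioo a₁ b₁ ×ˢ Set.Ioo a₂ b₂) := by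
  have hR : 0 < b₁ - a₁ := sub_pos.2 h₁
  have hR : 0 < b₂ - a₂ := sub_pos.2 h₂
  rw [ptQ_restrict, ptL, ← Measure.map_prod_map _ _ (by fun_prop) (by fun_prop), pt_map1 _ _ h₁, pt_map1 _ _ h₂,
    Measure.prod_smul_left, Measure.prod_smul_right, Measure.prod_restrict, smul_smul, ← ENNReal.ofReal_mul (by positivity),
    mul_inv]
  rfl

lemma pt_max (R S : ℝ) (hR : 0 < R) (hS : 0 < S) : max R S ^ 2 * (R * S)⁻¹ = max (R / S) (S / R) := by
  rcases le_total R S with h | h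
  · rw [max_eq_right h, max_eq_right]
    · field_simp
    · rw [div_le_div_iff₀ hS hR]; nlinarith
  · rw [max_eq_left h, max_eq_left]
    · field_simp
    · rw [div_le_div_iff₀ hR hS]; nlinarith

theorem poincare_aux 
    (a₁ b₁ a₂ b₂ : ℝ) (h₁ : a₁ < b₁) (h₂ : a₂ < b₂)
    (V : ℝ × ℝ → ℝ) (hV : Measurable V) (hV0 : ∀ x, 0 ≤ V x)
    (w : ℝ × ℝ → ℝ) (U : Set (ℝ × ℝ)) (hU : IsOpen U)
    (hcl : closure ((Set.Ioo a₁ b₁) ×ˢ (Set.Ioo a₂ b₂)) ⊆ U)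
    (hw : ContDiffOn ℝ 1 w U)
    (h0 : (∫ x in (Set.Ioo a₁ b₁) ×ˢ (Set.Ioo a₂ b₂), w x) = 0)
    (avN : Set ℝ → (ℝ → ℝ≥0∞) → ℝ≥0∞)
    (havN : ∀ I h (g : ℝ → NNReal), Measurable g → 
      (∫⁻ y in I, ENNReal.ofReal (Real.exp (g y) - 1 - (g y : ℝ))) ≤ volume I →
      ∫⁻ y in I, h y * (g y : ℝ≥0∞) ≤ avN I h) :
      (∫⁻ x in (Set.Ioo a₁ b₁) ×ˢ (Set.Ioo a₂ b₂),
          ENNReal.ofReal (V x * w x ^ 2)) ≤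
        ENNReal.ofReal (256 * max ((b₁ - a₁) / (b₂ - a₂)) ((b₂ - a₂) / (b₁ - a₁))) *
          (∫⁻ x in Set.Ioo a₁ b₁, avN (Set.Ioo a₂ b₂) (fun y => ENNReal.ofReal (V (x, y)))) *
          ∫⁻ x in (Set.Ioo a₁ b₁) ×ˢ (Set.Ioo a₂ b₂),
            ENNReal.ofReal (‖fderiv ℝ w x‖ ^ 2) := by
  have hR1 : 0 < b₁ - a₁ := sub_pos.2 h₁
  have hR2 : 0 < b₂ - a₂ := sub_pos.2 h₂
  set L := ptL a₁ b₁ a₂ b₂ with hL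
  set Rc := Set.Ioo a₁ b₁ ×ˢ Set.Ioo a₂ b₂ with hRc
  have hRm : MeasurableSet Rc := measurableSet_Ioo.prod measurableSet_Ioo
  have hLe := pt_emb a₁ b₁ a₂ b₂ h₁ h₂
  have hLm := pt_map2 a₁ b₁ a₂ b₂ h₁ h₂
  let D : ℝ × ℝ →L[ℝ] ℝ × ℝ :=
    ((b₁ - a₁) • ContinuousLinearMap.fst ℝ ℝ ℝ).prod ((b₂ - a₂) • ContinuousLinearMap.snd ℝ ℝ ℝ)
  have hLD : ∀ u, HasFDerivAt L D u := by
    intro u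
    have : L = fun u => (a₁, a₂) + D u := by
      ext u <;> simp [L, ptL, D]
    rw [this]
    exact D.hasFDerivAt.const_add _
  have hLc : ContDiff ℝ 1 L := by
    have : L = fun u => (a₁, a₂) + D u := by
      ext u <;> simp [L, ptL, D]
    rw [this]
    fun_prop
  set ρ := max (b₁ - a₁) (b₂ - a₂) with hρ
  have hρ0 : 0 < ρ := lt_max_of_lt_left hR1
  have hDn : ‖D‖ ≤ ρ := by
    apply ContinuousLinearMap.opNorm_le_bound _ hρ0.le
    intro u
    rw [Prod.norm_def, max_le_iff]
    simp only [D, ContinuousLinearMap.prod_apply, _root_.smul_apply, ContinuousLinearMap.coe_fst', ContinuousLinearMap.coe_snd', norm_smul, Real.norm_of_nonneg hR1.le, Real.norm_of_nonneg hR2.le]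
    exact ⟨mul_le_mul (le_max_left _ _) (norm_fst_le u) (norm_nonneg _) hρ0.le,
      mul_le_mul (le_max_right _ _) (norm_snd_le u) (norm_nonneg _) hρ0.le⟩
  set W := w ∘ L with hWdef
  have hUo : IsOpen (L ⁻¹' U) := hU.preimage hLc.continuous
  have hmaps : Set.MapsTo L ptQ Rc := by
    intro u hu
    simp only [L, ptL, Prod.map, hRc]
    refine ⟨⟨?_, ?_⟩, ?_, ?_⟩ <;> nlinarith [hu.1.1, hu.1.2, hu.2.1, hu.2.2]
  have hclW : closure ptQ ⊆ L ⁻¹' U := by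
    intro u hu
    exact hcl (map_mem_closure hLc.continuous hu hmaps)
  have hWc : ContDiffOn ℝ 1 W (L ⁻¹' U) := hw.comp hLc.contDiffOn (fun u hu => hu)
  have hW0 : ∫ x in ptQ, W x = 0 := by
    have := hLe.integral_map (μ := volume.restrict ptQ) w
    rw [hLm, integral_smul_measure, h0, smul_zero] at this
    exact this.symm
  have hHle : ∫⁻ u in ptQ, ‖fderiv ℝ W u‖ₑ ^ 2 ≤
      ENNReal.ofReal (max ((b₁ - a₁) / (b₂ - a₂)) ((b₂ - a₂) / (b₁ - a₁))) *
        ∫⁻ x in Rc, ENNReal.ofReal (‖fderiv ℝ w x‖ ^ 2) := by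
    have := hLe.lintegral_map (μ := volume.restrict ptQ) (fun x => ENNReal.ofReal (‖fderiv ℝ w x‖ ^ 2))
    rw [hLm, lintegral_smul_measure, smul_eq_mul] at this
    rw [← pt_max _ _ hR1 hR2, ENNReal.ofReal_mul (by positivity), mul_assoc, this,
      ← lintegral_const_mul' _ _ (by simp)]
    refine setLIntegral_mono' ptQ_meas fun u hu => ?_
    have hd : DifferentiableAt ℝ w (L u) := 
      (hw.contDiffAt (hU.mem_nhds (hclW (subset_closure hu)))).differentiableAt (by norm_num)
    have : fderiv ℝ W u = (fderiv ℝ w (L u)).comp D := (hd.hasFDerivAt.comp u (hLD u)).fderiv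
    rw [this, ← ENNReal.ofReal_mul (by positivity), ← ofReal_norm, ← ENNReal.ofReal_pow (norm_nonneg _)]
    apply ENNReal.ofReal_le_ofReal
    rw [← mul_pow]
    gcongr
    refine (ContinuousLinearMap.opNorm_comp_le _ _).trans ?_
    rw [mul_comm]
    gcongr
  have hfin : ∫⁻ u in ptQ, ‖fderiv ℝ W u‖ₑ ^ 2 ≠ ∞ := by
    have hK : IsCompact (closure ptQ) := by
      rw [closure_prod_eq, closure_Ioo (by norm_num)]
      exact isCompact_Icc.prod isCompact_Icc
    obtain ⟨B, hB⟩ := hK.exists_bound_of_continuousOn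
      ((hWc.continuousOn_fderiv_of_isOpen hUo (by norm_num)).mono hclW)
    have : ∫⁻ u in ptQ, ‖fderiv ℝ W u‖ₑ ^ 2 ≤ ∫⁻ u in ptQ, ENNReal.ofReal B ^ 2 := by
      refine setLIntegral_mono' ptQ_meas fun u hu => ?_
      rw [← ofReal_norm]
      gcongr
      exact hB u (subset_closure hu)
    refine ne_top_of_le_ne_top ?_ this
    rw [lintegral_const, Measure.restrict_apply .univ, Set.univ_inter, ptQ_vol, mul_one]
    simp
  have hsurj : ∀ x ∈ Rc, ∃ u ∈ ptQ, L u = x := by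
    intro x hx
    refine ⟨((x.1 - a₁) / (b₁ - a₁), (x.2 - a₂) / (b₂ - a₂)), ⟨⟨?_, ?_⟩, ?_, ?_⟩, ?_⟩
    · exact div_pos (sub_pos.2 hx.1.1) hR1
    · rw [div_lt_one hR1]; linarith [hx.1.2]
    · exact div_pos (sub_pos.2 hx.2.1) hR2
    · rw [div_lt_one hR2]; linarith [hx.2.2]
    · ext <;> simp only [L, ptL, Prod.map] <;> field_simp <;> ring
  by_cases hz : ∫⁻ u in ptQ, ‖fderiv ℝ W u‖ₑ ^ 2 = 0
  · have : ∫⁻ x in Rc, ENNReal.ofReal (V x * w x ^ 2) = 0 := by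
      rw [← le_zero_iff, ← lintegral_zero (μ := volume.restrict Rc)]
      refine setLIntegral_mono' hRm fun x hx => ?_
      obtain ⟨u, hu, rfl⟩ := hsurj x hx
      have : w (L u) = 0 := pt_unit_zero W _ hUo hclW hWc hW0 hz u hu
      simp [this]
    rw [this]; exact bot_le
  set H := (∫⁻ u in ptQ, ‖fderiv ℝ W u‖ₑ ^ 2).toReal with hHdef
  have hH : 0 < H := ENNReal.toReal_pos hz hfin
  have hH' : ∫⁻ u in ptQ, ‖fderiv ℝ W u‖ₑ ^ 2 = ENNReal.ofReal H := (ENNReal.ofReal_toReal hfin).symm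
  have hwc : ContinuousOn w Rc := hw.continuousOn.mono (subset_closure.trans hcl)
  have hline : ∀ x ∈ Set.Ioo a₁ b₁, ∫⁻ y in Set.Ioo a₂ b₂, ENNReal.ofReal (V (x, y) * w (x, y) ^ 2) ≤
      ENNReal.ofReal (256 * H) * avN (Set.Ioo a₂ b₂) (fun y => ENNReal.ofReal (V (x, y))) := by
    intro x hx
    classical
    let g : ℝ → NNReal := (Set.Ioo a₂ b₂).piecewise (fun y => Real.toNNReal (w (x, y) ^ 2 / (256 * H))) (fun _ => 0)
    have hgv : ∀ y ∈ Set.Ioo a₂ b₂, (g y : ℝ) = w (x, y) ^ 2 / (256 * H) := by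
      intro y hy
      simp only [g, Set.piecewise_eq_of_mem _ _ _ hy]
      rw [Real.coe_toNNReal _ (by positivity)]
    have hgm : Measurable g := by
      apply ContinuousOn.measurable_piecewise _ continuousOn_const measurableSet_Ioo
      apply continuous_real_toNNReal.comp_continuousOn
      apply ContinuousOn.div_const
      apply ContinuousOn.pow
      exact hwc.comp (by fun_prop) (fun y hy => ⟨hx, hy⟩)
    have hg1 : (∫⁻ y in Set.Ioo a₂ b₂, ENNReal.ofReal (Real.exp (g y) - 1 - (g y : ℝ))) ≤ volume (Set.Ioo a₂ b₂) := by
      have hm1 := (pt_emb1 a₂ b₂ h₂).lintegral_map (μ := volume.restrict (Set.Ioo (0:ℝ) 1)) 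
        (fun y => ENNReal.ofReal (Real.exp (g y) - 1 - (g y : ℝ)))
      rw [pt_map1 _ _ h₂, lintegral_smul_measure, smul_eq_mul] at hm1
      obtain ⟨s, hs, rfl⟩ : ∃ s ∈ Set.Ioo (0:ℝ) 1, a₁ + (b₁ - a₁) * s = x := by
        refine ⟨(x - a₁) / (b₁ - a₁), ⟨div_pos (sub_pos.2 hx.1) hR1, ?_⟩, ?_⟩
        · rw [div_lt_one hR1]; linarith [hx.2]
        · field_simp; ring
      have hle : ENNReal.ofReal (b₂ - a₂)⁻¹ * ∫⁻ y in Set.Ioo a₂ b₂, ENNReal.ofReal (Real.exp (g y) - 1 - (g y : ℝ)) ≤ 1 := by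
        rw [hm1]
        refine le_trans ?_ (pt_unit W _ hUo hclW hWc hW0 H hH hH' s hs)
        refine setLIntegral_mono' measurableSet_Ioo fun t ht => ?_
        rw [hgv _ ⟨by nlinarith [ht.1], by nlinarith [ht.2]⟩]
        exact le_rfl
      rw [Real.volume_Ioo]
      calc _ = ENNReal.ofReal (b₂ - a₂) * (ENNReal.ofReal (b₂ - a₂)⁻¹ * ∫⁻ y in Set.Ioo a₂ b₂, ENNReal.ofReal (Real.exp (g y) - 1 - (g y : ℝ))) := by
            rw [← mul_assoc, ← ENNReal.ofReal_mul hR2.le, mul_inv_cancel₀ hR2.ne', ENNReal.ofReal_one, one_mul]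
        _ ≤ ENNReal.ofReal (b₂ - a₂) * 1 := by gcongr
        _ = _ := mul_one _
    calc _ = ∫⁻ y in Set.Ioo a₂ b₂, ENNReal.ofReal (256 * H) * (ENNReal.ofReal (V (x, y)) * (g y : ℝ≥0∞)) := by
          refine setLIntegral_congr_fun measurableSet_Ioo fun y hy => ?_
          have : (g y : ℝ≥0∞) = ENNReal.ofReal (w (x, y) ^ 2 / (256 * H)) := by
            rw [← hgv y hy, ENNReal.ofReal_coe_nnreal]
          beta_reduce
          rw [this, ← ENNReal.ofReal_mul (hV0 _), ← ENNReal.ofReal_mul (by positivity)]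
          congr 1
          field_simp
      _ = ENNReal.ofReal (256 * H) * ∫⁻ y in Set.Ioo a₂ b₂, ENNReal.ofReal (V (x, y)) * (g y : ℝ≥0∞) :=
          lintegral_const_mul' _ _ ENNReal.ofReal_ne_top
      _ ≤ _ := by gcongr; exact havN _ (fun y => ENNReal.ofReal (V (x, y))) g hgm hg1
  have hprod : (volume : Measure (ℝ × ℝ)).restrict Rc =
      (volume.restrict (Set.Ioo a₁ b₁)).prod (volume.restrict (Set.Ioo a₂ b₂)) := by
    rw [Measure.prod_restrict]; rfl
  have haem : AEMeasurable (fun x => ENNReal.ofReal (V x * w x ^ 2)) (volume.restrict Rc) :=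
    (hV.aemeasurable.mul ((hwc.aemeasurable hRm).pow_const 2)).ennreal_ofReal
  calc _ = ∫⁻ x in Set.Ioo a₁ b₁, ∫⁻ y in Set.Ioo a₂ b₂, ENNReal.ofReal (V (x, y) * w (x, y) ^ 2) := by
        rw [hprod] at haem ⊢
        exact lintegral_prod _ haem
    _ ≤ ∫⁻ x in Set.Ioo a₁ b₁, ENNReal.ofReal (256 * H) * avN (Set.Ioo a₂ b₂) (fun y => ENNReal.ofReal (V (x, y))) :=
        setLIntegral_mono' measurableSet_Ioo hline
    _ = ENNReal.ofReal (256 * H) * ∫⁻ x in Set.Ioo a₁ b₁, avN (Set.Ioo a₂ b₂) (fun y => ENNReal.ofReal (V (x, y))) :=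
        lintegral_const_mul' _ _ ENNReal.ofReal_ne_top
    _ ≤ _ := by
        rw [ENNReal.ofReal_mul (by norm_num), ← hH', ENNReal.ofReal_mul (by norm_num)]
        refine (mul_le_mul_left (mul_le_mul_right hHle (ENNReal.ofReal 256)) _).trans (le_of_eq ?_)
        ring

/-- Lemma `CLRl1`: there is a constant `C > 0` such that for all bounded open intervals
`I₁, I₂` of lengths `R₁, R₂`, all mean-zero `w ∈ W¹₂(I₁×I₂) ∩ C(cl(I₁×I₂))` (realized as
functions continuously differentiable on a neighborhood of the closed rectangle) and all
measurable `V ≥ 0`: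
`∫_{I₁×I₂} V·w² dx ≤ C·max{R₁/R₂, R₂/R₁}·‖V‖_{L₁(I₁,L_B(I₂))}·∫_{I₁×I₂} |∇w|² dx`. -/
theorem poincare_trudinger_rectangle : ∃ C : ℝ, 0 < C ∧
    ∀ (a₁ b₁ a₂ b₂ : ℝ), a₁ < b₁ → a₂ < b₂ →
    ∀ V : ℝ × ℝ → ℝ, Measurable V → (∀ x, 0 ≤ V x) →
    ∀ (w : ℝ × ℝ → ℝ) (U : Set (ℝ × ℝ)), IsOpen U →
      closure ((Set.Ioo a₁ b₁) ×ˢ (Set.Ioo a₂ b₂)) ⊆ U →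
      ContDiffOn ℝ 1 w U →
      (∫ x in (Set.Ioo a₁ b₁) ×ˢ (Set.Ioo a₂ b₂), w x) = 0 →
      (∫⁻ x in (Set.Ioo a₁ b₁) ×ˢ (Set.Ioo a₂ b₂),
          ENNReal.ofReal (V x * w x ^ 2)) ≤
        ENNReal.ofReal (C * max ((b₁ - a₁) / (b₂ - a₂)) ((b₂ - a₂) / (b₁ - a₁))) *
          mixedNormL1B (Set.Ioo a₁ b₁) (Set.Ioo a₂ b₂) (fun x => ENNReal.ofReal (V x)) *
          ∫⁻ x in (Set.Ioo a₁ b₁) ×ˢ (Set.Ioo a₂ b₂),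
            ENNReal.ofReal (‖fderiv ℝ w x‖ ^ 2) := by
  refine ⟨256, by norm_num, ?_⟩
  intro a₁ b₁ a₂ b₂ h₁ h₂ V hV hV0 w U hU hcl hw h0
  exact poincare_aux a₁ b₁ a₂ b₂ h₁ h₂ V hV hV0 w U hU hcl hw h0 avNormB
    (fun I h g hg hg1 => le_sSup ⟨g, hg, hg1, rfl⟩)
end
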